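/- arXiv:1308.6803 — 6 statements merged into one kernel-verified Lean document; each statement's English description precedes it below -/
import Mathlib

section
/- Let n ≥ 1 be an integer. Then the Euler–Frobenius polynomial P_n has exactly n zeros, all of which are real, simple and non-positive; P_n(0) = 0; P_n(-1) = 0 if and only if n is even; moreover, if n = 2k then exactly k−1 zeros lie in (−∞,−1) and k−1 zeros lie in (−1,0), while if n = 2k+1 then exactly k zeros lie in each of the intervals (−∞,−1) and (−1,0). -/
open Polynomial

/-- The Euler–Frobenius polynomials `P_n`, defined by
`∑_{ν≥0} ν^n z^ν = P_n(z)/(1-z)^{n+1}`, via the equivalent recurrence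
`P_0 = 1`, `P_{n+1}(z) = z(1-z)P_n'(z) + (n+1) z P_n(z)`. -/
noncomputable def eulerFrobenius : ℕ → Polynomial ℝ
  | 0 => 1
  | n + 1 =>
      X * (1 - X) * derivative (eulerFrobenius n) + C ((n : ℝ) + 1) * X * eulerFrobenius n

/-- The polynomial `Q_n` with `P_n(z) = (1 - z) ^ (n + 1) * Q_n(1 / (1 - z))`: in the variable
`w = 1 / (1 - z)` the operator `z d/dz` becomes `w (w - 1) d/dw`. -/
noncomputable def eulerFrobeniusMobius : ℕ → ℝ[X]
  | 0 => X
  | n + 1 => X * (X - 1) * derivative (eulerFrobeniusMobius n)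

theorem eulerFrobenius_eval_eq (n : ℕ) {x : ℝ} (hx : x ≠ 1) :
    (eulerFrobenius n).eval x =
      (1 - x) ^ (n + 1) * (eulerFrobeniusMobius n).eval (1 - x)⁻¹ := by
  induction n generalizing x with
  | zero =>
    have : 1 - x ≠ 0 := sub_ne_zero.2 hx.symm
    simp [eulerFrobenius, eulerFrobeniusMobius, this]
  | succ n ih =>
    have h0 : 1 - x ≠ 0 := sub_ne_zero.2 hx.symm
    have hs : HasDerivAt (fun y : ℝ => 1 - y) (-1) x := by
      simpa using (hasDerivAt_id x).const_sub 1
    have hd := (hs.pow (n + 1)).mul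
      (((eulerFrobeniusMobius n).hasDerivAt (1 - x)⁻¹).comp x (hs.inv h0))
    have he : (fun y => (eulerFrobenius n).eval y) =ᶠ[nhds x] fun y =>
        (1 - y) ^ (n + 1) * (eulerFrobeniusMobius n).eval (1 - y)⁻¹ := by
      filter_upwards [isOpen_ne.mem_nhds hx] with y hy using ih hy
    have hu := ((eulerFrobenius n).hasDerivAt x).unique (hd.congr_of_eventuallyEq he)
    simp only [eulerFrobenius, eulerFrobeniusMobius, eval_add, eval_mul, eval_X, eval_sub,
      eval_one, eval_C]
    rw [hu, ih hx]
    simp only [Function.comp_apply, Pi.pow_apply, Pi.inv_apply, Nat.add_sub_cancel]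
    push_cast
    field_simp
    ring

theorem eulerFrobeniusMobius_eval_zero (n : ℕ) : (eulerFrobeniusMobius n).eval 0 = 0 := by
  cases n <;> simp [eulerFrobeniusMobius]

theorem eulerFrobeniusMobius_eval_one (n : ℕ) : (eulerFrobeniusMobius (n + 1)).eval 1 = 0 := by
  simp [eulerFrobeniusMobius]

theorem eulerFrobeniusMobius_comp_one_sub (n : ℕ) :
    (eulerFrobeniusMobius (n + 1)).comp (1 - X) = (-1) ^ n * eulerFrobeniusMobius (n + 1) := by
  induction n with
  | zero =>
    simp [eulerFrobeniusMobius]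
    ring
  | succ n ih =>
    have h := congrArg derivative ih
    have hc : ((-1 : ℝ[X]) ^ n) = C ((-1) ^ n) := by simp
    rw [derivative_comp, hc, derivative_C_mul, ← hc] at h
    have h' : (derivative (eulerFrobeniusMobius (n + 1))).comp (1 - X) =
        -((-1) ^ n * derivative (eulerFrobeniusMobius (n + 1))) := by
      rw [← h]
      simp
    rw [eulerFrobeniusMobius]
    simp only [mul_comp, sub_comp, X_comp, one_comp, h']
    ring

theorem eulerFrobeniusMobius_eval_one_sub (n : ℕ) (w : ℝ) :
    (eulerFrobeniusMobius (n + 1)).eval (1 - w) =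
      (-1) ^ n * (eulerFrobeniusMobius (n + 1)).eval w := by
  simpa [eval_comp] using congrArg (eval w) (eulerFrobeniusMobius_comp_one_sub n)

theorem eulerFrobeniusMobius_ne_zero_and_le_card (n : ℕ) :
    eulerFrobeniusMobius (n + 1) ≠ 0 ∧
      n + 2 ≤ (eulerFrobeniusMobius (n + 1)).roots.toFinset.card := by
  have hX1 : (X - 1 : ℝ[X]) ≠ 0 := X_sub_C_ne_zero 1
  induction n with
  | zero =>
    have h0 : eulerFrobeniusMobius 1 ≠ 0 := by
      simpa [eulerFrobeniusMobius] using hX1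
    refine ⟨h0, ?_⟩
    refine (Finset.card_pair (zero_ne_one (α := ℝ))).symm.le.trans (Finset.card_le_card ?_)
    intro w hw
    rw [Multiset.mem_toFinset, mem_roots h0]
    simp only [Finset.mem_insert, Finset.mem_singleton] at hw
    rcases hw with rfl | rfl <;> simp [eulerFrobeniusMobius]
  | succ n ih =>
    obtain ⟨h0, hc⟩ := ih
    set q := eulerFrobeniusMobius (n + 1) with hq
    have hcard := card_roots_toFinset_le_card_roots_derivative_sdiff_roots_succ q
    have hd : derivative q ≠ 0 := by
      intro hd
      simp only [hd, roots_zero, Multiset.toFinset_zero, Finset.empty_sdiff,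
        Finset.card_empty] at hcard
      omega
    have hne : eulerFrobeniusMobius (n + 1 + 1) ≠ 0 :=
      mul_ne_zero (mul_ne_zero X_ne_zero hX1) hd
    refine ⟨hne, ?_⟩
    have hdisj : Disjoint ({0, 1} : Finset ℝ)
        ((derivative q).roots.toFinset \ q.roots.toFinset) := by
      rw [Finset.disjoint_left]
      intro w hw hw'
      rw [Finset.mem_sdiff, Multiset.mem_toFinset, Multiset.mem_toFinset, mem_roots h0] at hw'
      simp only [Finset.mem_insert, Finset.mem_singleton] at hw
      rcases hw with rfl | rfl
      · exact hw'.2 (eulerFrobeniusMobius_eval_zero _)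
      · exact hw'.2 (eulerFrobeniusMobius_eval_one _)
    have hsub : ({0, 1} : Finset ℝ) ∪ ((derivative q).roots.toFinset \ q.roots.toFinset) ⊆
        (eulerFrobeniusMobius (n + 1 + 1)).roots.toFinset := by
      intro w hw
      rw [Multiset.mem_toFinset, mem_roots hne]
      simp only [Finset.mem_union, Finset.mem_insert, Finset.mem_singleton, Finset.mem_sdiff,
        Multiset.mem_toFinset, mem_roots hd, IsRoot.def] at hw
      rcases hw with (rfl | rfl) | hw
      · exact eulerFrobeniusMobius_eval_zero _
      · exact eulerFrobeniusMobius_eval_one _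
      · rw [eulerFrobeniusMobius, ← hq]
        simp [hw.1]
    have := Finset.card_le_card hsub
    rw [Finset.card_union_of_disjoint hdisj, Finset.card_pair zero_ne_one] at this
    omega

theorem eulerFrobenius_coeff_zero (n : ℕ) : (eulerFrobenius (n + 1)).coeff 0 = 0 := by
  simp [eulerFrobenius, mul_assoc]

theorem eulerFrobenius_coeff_succ (n k : ℕ) :
    (eulerFrobenius (n + 1)).coeff (k + 1) =
      (k + 1) * (eulerFrobenius n).coeff (k + 1) + (n + 1 - k) * (eulerFrobenius n).coeff k := by
  have h : eulerFrobenius (n + 1) = X * (derivative (eulerFrobenius n) -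
      X * derivative (eulerFrobenius n) + C ((n : ℝ) + 1) * eulerFrobenius n) := by
    rw [eulerFrobenius]
    ring
  rw [h, coeff_X_mul, coeff_add, coeff_sub, coeff_C_mul, coeff_derivative]
  cases k with
  | zero => simp
  | succ k =>
    rw [coeff_X_mul, coeff_derivative]
    push_cast
    ring

theorem eulerFrobenius_natDegree_le (n : ℕ) : (eulerFrobenius n).natDegree ≤ n := by
  induction n with
  | zero => simp [eulerFrobenius]
  | succ n ih =>
    rw [natDegree_le_iff_coeff_eq_zero] at ih ⊢
    intro k hk
    obtain ⟨k, rfl⟩ : ∃ j, k = j + 1 := ⟨k - 1, by omega⟩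
    rw [eulerFrobenius_coeff_succ, ih k (by omega), ih (k + 1) (by omega)]
    simp

theorem eulerFrobenius_coeff_nonneg (n k : ℕ) : 0 ≤ (eulerFrobenius n).coeff k := by
  induction n generalizing k with
  | zero =>
    rw [eulerFrobenius, coeff_one]
    split_ifs <;> norm_num
  | succ n ih =>
    cases k with
    | zero => rw [eulerFrobenius_coeff_zero]
    | succ k =>
      rw [eulerFrobenius_coeff_succ]
      rcases le_or_gt k n with hk | hk
      · have hk' : (k : ℝ) ≤ n := by exact_mod_cast hk
        exact add_nonneg (mul_nonneg (by positivity) (ih _))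
          (mul_nonneg (by linarith) (ih _))
      · rw [coeff_eq_zero_of_natDegree_lt ((eulerFrobenius_natDegree_le n).trans_lt hk)]
        simpa using mul_nonneg (by positivity : (0 : ℝ) ≤ k + 1) (ih (k + 1))

theorem eulerFrobenius_coeff_one (n : ℕ) : (eulerFrobenius (n + 1)).coeff 1 = 1 := by
  induction n with
  | zero => simp [eulerFrobenius]
  | succ n ih => simp [eulerFrobenius_coeff_succ (n + 1) 0, ih, eulerFrobenius_coeff_zero]

theorem eulerFrobenius_eval_pos (n : ℕ) {x : ℝ} (hx : 0 < x) :
    0 < (eulerFrobenius (n + 1)).eval x := by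
  have hc := eulerFrobenius_coeff_one n
  have hdeg : 1 ≤ (eulerFrobenius (n + 1)).natDegree :=
    le_natDegree_of_ne_zero (by rw [hc]; exact one_ne_zero)
  rw [eval_eq_sum_range]
  refine Finset.sum_pos' (fun i _ => mul_nonneg (eulerFrobenius_coeff_nonneg _ _) (by positivity))
    ⟨1, Finset.mem_range.2 (by omega), ?_⟩
  rw [hc]
  simpa using hx

theorem eulerFrobenius_ne_zero (n : ℕ) : eulerFrobenius (n + 1) ≠ 0 := by
  intro h
  simpa [h] using eulerFrobenius_eval_pos n one_pos

theorem eulerFrobenius_le_card_roots_toFinset (n : ℕ) :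
    n + 1 ≤ (eulerFrobenius (n + 1)).roots.toFinset.card := by
  obtain ⟨h0, hc⟩ := eulerFrobeniusMobius_ne_zero_and_le_card n
  have he : n + 1 ≤ ((eulerFrobeniusMobius (n + 1)).roots.toFinset.erase 0).card :=
    (by omega : n + 1 ≤ _ - 1).trans Finset.pred_card_le_card_erase
  refine he.trans (Finset.card_le_card_of_injOn (fun w => 1 - w⁻¹) ?_ ?_)
  · intro w hw
    simp only [Finset.coe_erase, Set.mem_sdiff, Finset.mem_coe, Multiset.mem_toFinset,
      mem_roots h0, IsRoot.def, Set.mem_singleton_iff] at hw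
    have hw1 : 1 - w⁻¹ ≠ 1 := by simpa using hw.2
    simp only [Finset.mem_coe, Multiset.mem_toFinset, mem_roots (eulerFrobenius_ne_zero n),
      IsRoot.def]
    rw [eulerFrobenius_eval_eq _ hw1]
    simp [hw.1]
  · intro w _ v _ h
    simpa using h

theorem eulerFrobenius_card_roots (n : ℕ) :
    Multiset.card (eulerFrobenius (n + 1)).roots = n + 1 :=
  le_antisymm ((card_roots' _).trans (eulerFrobenius_natDegree_le _))
    ((eulerFrobenius_le_card_roots_toFinset n).trans (Multiset.toFinset_card_le _))

theorem eulerFrobenius_nodup_roots (n : ℕ) : (eulerFrobenius (n + 1)).roots.Nodup := by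
  rw [← Multiset.toFinset_card_eq_card_iff_nodup]
  refine le_antisymm (Multiset.toFinset_card_le _) ?_
  rw [eulerFrobenius_card_roots]
  exact eulerFrobenius_le_card_roots_toFinset n

theorem eulerFrobenius_eval_inv (n : ℕ) {x : ℝ} (hx : x < 0) :
    (eulerFrobenius (n + 1)).eval x⁻¹ * x ^ (n + 2) = (eulerFrobenius (n + 1)).eval x := by
  have hx0 : x ≠ 0 := hx.ne
  have h1 : 1 - x ≠ 0 := by linarith
  have h2 : x - 1 ≠ 0 := by linarith
  have hxi : x⁻¹ < 0 := inv_lt_zero.2 hx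
  rw [eulerFrobenius_eval_eq _ (by linarith : x ≠ 1),
    eulerFrobenius_eval_eq _ (by linarith : x⁻¹ ≠ 1),
    show (1 - x⁻¹)⁻¹ = 1 - (1 - x)⁻¹ by field_simp; ring,
    eulerFrobeniusMobius_eval_one_sub, show 1 - x = (-1) * ((1 - x⁻¹) * x) by field_simp; ring,
    mul_pow, mul_pow]
  ring

theorem eulerFrobenius_eval_neg_one_of_even {n : ℕ} (hn : 1 ≤ n) (h : Even n) :
    (eulerFrobenius n).eval (-1) = 0 := by
  obtain ⟨n, rfl⟩ := Nat.exists_eq_add_of_le' hn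
  have hi := eulerFrobenius_eval_inv n (x := -1) (by norm_num)
  have ho : Odd (n + 2) := h.add_one
  rw [ho.neg_one_pow, inv_neg_one] at hi
  linarith

theorem eulerFrobenius_card_filter_eq (n : ℕ) :
    ((eulerFrobenius (n + 1)).roots.toFinset.filter (fun x => x < -1)).card =
      ((eulerFrobenius (n + 1)).roots.toFinset.filter (fun x => -1 < x ∧ x < 0)).card := by
  have hroot {x : ℝ} (hx : x < 0) (h : (eulerFrobenius (n + 1)).eval x = 0) :
      (eulerFrobenius (n + 1)).eval x⁻¹ = 0 := by
    rw [← eulerFrobenius_eval_inv n hx] at h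
    exact (mul_eq_zero.1 h).resolve_right (pow_ne_zero _ hx.ne)
  refine Finset.card_nbij' (fun x => x⁻¹) (fun x => x⁻¹) ?_ ?_ (fun _ _ => inv_inv _)
    (fun _ _ => inv_inv _)
  all_goals
    intro x hx
    simp only [Finset.coe_filter, Set.mem_ofPred_eq, Multiset.mem_toFinset,
      mem_roots (eulerFrobenius_ne_zero n), IsRoot.def] at hx ⊢
  · have hx0 : x < 0 := by linarith
    have := inv_lt_zero.2 hx0
    have := mul_inv_cancel₀ hx0.ne
    exact ⟨hroot hx0 hx.1, by nlinarith, by assumption⟩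
  · have hx0 : x < 0 := hx.2.2
    have := inv_lt_zero.2 hx0
    have := mul_inv_cancel₀ hx0.ne
    exact ⟨hroot hx0 hx.1, by nlinarith⟩

theorem card_eq_card_filter_add_of_nonpos {s : Finset ℝ} (hs : ∀ x ∈ s, x ≤ 0) :
    s.card = (s.filter (fun x => x < -1)).card + (s.filter (fun x => -1 < x ∧ x < 0)).card +
      (s.filter (fun x => x = -1)).card + (s.filter (fun x => x = 0)).card := by
  simp only [Finset.card_filter]
  rw [Finset.card_eq_sum_ones, ← Finset.sum_add_distrib, ← Finset.sum_add_distrib,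
    ← Finset.sum_add_distrib]
  refine Finset.sum_congr rfl fun x hx => ?_
  have := hs x hx
  grind

/-- For `n ≥ 1`, the Euler–Frobenius polynomial `P_n` has exactly `n` zeros, all real, simple
and non-positive; `P_n(0) = 0`; `P_n(-1) = 0` iff `n` is even; and if `n = 2k` then exactly
`k-1` zeros lie in each of `(-∞,-1)` and `(-1,0)`, while if `n = 2k+1` then exactly `k` zeros
lie in each of those intervals. -/
theorem eulerFrobenius_zeros (n : ℕ) (hn : 1 ≤ n) :
    Multiset.card (eulerFrobenius n).roots = n ∧
    (∀ x ∈ (eulerFrobenius n).roots, (eulerFrobenius n).roots.count x = 1) ∧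
    (∀ x ∈ (eulerFrobenius n).roots, x ≤ 0) ∧
    (eulerFrobenius n).eval 0 = 0 ∧
    ((eulerFrobenius n).eval (-1) = 0 ↔ Even n) ∧
    (∀ k : ℕ, n = 2 * k →
      Multiset.card ((eulerFrobenius n).roots.filter (fun x => x < -1)) = k - 1 ∧
      Multiset.card ((eulerFrobenius n).roots.filter (fun x => -1 < x ∧ x < 0)) = k - 1) ∧
    (∀ k : ℕ, n = 2 * k + 1 →
      Multiset.card ((eulerFrobenius n).roots.filter (fun x => x < -1)) = k ∧
      Multiset.card ((eulerFrobenius n).roots.filter (fun x => -1 < x ∧ x < 0)) = k) := by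
  obtain ⟨n, rfl⟩ := Nat.exists_eq_add_of_le' hn
  have hP := eulerFrobenius_ne_zero n
  have hnd := eulerFrobenius_nodup_roots n
  have hcard := eulerFrobenius_card_roots n
  have hnonpos : ∀ x ∈ (eulerFrobenius (n + 1)).roots, x ≤ 0 := fun x hx =>
    not_lt.1 fun h => (eulerFrobenius_eval_pos n h).ne' ((mem_roots hP).1 hx)
  have h0 : (eulerFrobenius (n + 1)).eval 0 = 0 := by
    rw [← coeff_zero_eq_eval_zero, eulerFrobenius_coeff_zero]
  have hfilter (p : ℝ → Prop) [DecidablePred p] :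
      Multiset.card ((eulerFrobenius (n + 1)).roots.filter p) =
        ((eulerFrobenius (n + 1)).roots.toFinset.filter p).card := by
    rw [← Multiset.toFinset_filter, Multiset.toFinset_card_of_nodup (hnd.filter p)]
  have hsum := card_eq_card_filter_add_of_nonpos
    (s := (eulerFrobenius (n + 1)).roots.toFinset) (by simpa using hnonpos)
  have hsymm := eulerFrobenius_card_filter_eq n
  have hsingle (a : ℝ) : ((eulerFrobenius (n + 1)).roots.toFinset.filter (fun x => x = a)).card =
      if (eulerFrobenius (n + 1)).eval a = 0 then 1 else 0 := by
    rw [Finset.filter_eq']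
    simp only [Multiset.mem_toFinset, mem_roots hP, IsRoot.def]
    split_ifs <;> simp
  rw [hsingle, hsingle, if_pos h0, Multiset.toFinset_card_of_nodup hnd, hcard] at hsum
  have hneg : (eulerFrobenius (n + 1)).eval (-1) = 0 ↔ Even (n + 1) := by
    refine ⟨fun h => ?_, eulerFrobenius_eval_neg_one_of_even hn⟩
    rw [if_pos h] at hsum
    rw [Nat.even_iff]
    omega
  refine ⟨hcard, fun x hx => Multiset.count_eq_one_of_mem hnd hx, hnonpos, h0, hneg, ?_, ?_⟩
  all_goals
    intro k hk
    rw [hfilter, hfilter]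
    simp only [hneg, Nat.even_iff] at hsum
    split_ifs at hsum <;> omega
end

section
/- Let γ > 0 and let j ≥ 1 be a fixed integer. Then lim_{n→∞} {n j}_γ · j! · Γ(2j+2γ−1) / ( Γ(j+2γ−1) · ( j(j+2γ−1) )^n ) = 1; equivalently, {n j}_γ ∼ Γ(j+2γ−1)/( j! Γ(2j+2γ−1) ) · ( j(j+2γ−1) )^n as n → ∞. -/
/-- The Jacobi-Stirling numbers of the second kind with parameter `γ`, defined by the
triangular recurrence `{n j}_γ = {n-1 j-1}_γ + j(j+2γ-1){n-1 j}_γ`,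
`{n 0}_γ = δ_{n,0}`, `{0 j}_γ = δ_{0,j}`. -/
noncomputable def jacobiStirling (γ : ℝ) : ℕ → ℕ → ℝ
  | 0, 0 => 1
  | 0, _ + 1 => 0
  | _ + 1, 0 => 0
  | n + 1, j + 1 =>
      jacobiStirling γ n j + ((j : ℝ) + 1) * (((j : ℝ) + 1) + 2 * γ - 1) * jacobiStirling γ n (j + 1)

open Finset in
/-- Explicit formula for the solution of a triangular recurrence with pairwise distinct weights. -/
theorem eq_sum_pow_div_prod_of_triangular_recurrence {F : Type*} [Field F] {v : ℕ → F}
    (hv : Function.Injective v) {a : ℕ → ℕ → F} (h00 : a 0 0 = 1) (h0 : ∀ j, a 0 (j + 1) = 0)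
    (hzero : ∀ n, a (n + 1) 0 = v 0 * a n 0)
    (hsucc : ∀ n j, a (n + 1) (j + 1) = a n j + v (j + 1) * a n (j + 1)) (n j : ℕ) :
    a n j = ∑ k ∈ range (j + 1), v k ^ n / ∏ i ∈ (range (j + 1)).erase k, (v k - v i) := by
  induction n generalizing j with
  | zero =>
    have hdeg : (1 : Polynomial F).degree < #(range (j + 1)) := by
      rw [Polynomial.degree_one, card_range]
      exact_mod_cast Nat.succ_pos j
    have h := Lagrange.coeff_eq_sum (s := range (j + 1)) hv.injOn hdeg
    rw [card_range, Nat.add_sub_cancel, Polynomial.coeff_one] at h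
    simp only [Polynomial.eval_one] at h
    simp only [pow_zero, ← h]
    cases j with
    | zero => simp [h00]
    | succ j => simp [h0]
  | succ n ih =>
    cases j with
    | zero => simp [hzero, ih, pow_succ']
    | succ j =>
      rw [hsucc, ih, ih, sum_range_succ _ (j + 1), sum_range_succ _ (j + 1), mul_add, mul_sum,
        ← add_assoc, ← sum_add_distrib]
      congr 1
      · refine sum_congr rfl fun k hk => ?_
        have hkj : k ≠ j + 1 := (mem_range.mp hk).ne
        have hsub : v k - v (j + 1) ≠ 0 := sub_ne_zero.mpr (hv.ne hkj)
        have hprod : ∏ i ∈ (range (j + 1)).erase k, (v k - v i) ≠ 0 :=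
          prod_ne_zero_iff.mpr fun i hi => sub_ne_zero.mpr (hv.ne (ne_of_mem_erase hi).symm)
        rw [range_add_one (n := j + 1), erase_insert_of_ne hkj.symm, prod_insert (by simp)]
        field_simp
        ring
      · rw [pow_succ', mul_div_assoc]

theorem Real.prod_range_add_mul_Gamma {x : ℝ} (hx : 0 < x) (m : ℕ) :
    (∏ i ∈ Finset.range m, (x + i)) * Real.Gamma x = Real.Gamma (x + m) := by
  induction m with
  | zero => simp
  | succ m ih =>
    rw [Finset.prod_range_succ, mul_right_comm, ih, Nat.cast_succ, ← add_assoc,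
      Real.Gamma_add_one (by positivity), mul_comm]

theorem prod_range_cast_sub_eq_factorial (j : ℕ) :
    ∏ i ∈ Finset.range j, ((j : ℝ) - i) = (Nat.factorial j : ℝ) := by
  rw [← Nat.descFactorial_self, Nat.descFactorial_eq_prod_range, Nat.cast_prod]
  exact Finset.prod_congr rfl fun i hi => (Nat.cast_sub (Finset.mem_range.mp hi).le).symm

/-- The weight `j(j+2γ-1)` of the Jacobi-Stirling recurrence. -/
noncomputable def jacobiStirlingWeight (γ : ℝ) (j : ℕ) : ℝ := j * (j + 2 * γ - 1)

theorem jacobiStirlingWeight_sub (γ : ℝ) (j i : ℕ) :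
    jacobiStirlingWeight γ j - jacobiStirlingWeight γ i =
      ((j : ℝ) - i) * ((j : ℝ) + 2 * γ - 1 + i) := by
  simp only [jacobiStirlingWeight]
  ring

theorem jacobiStirlingWeight_zero (γ : ℝ) : jacobiStirlingWeight γ 0 = 0 := by
  simp [jacobiStirlingWeight]

theorem jacobiStirlingWeight_strictMono {γ : ℝ} (hγ : 0 < γ) :
    StrictMono (jacobiStirlingWeight γ) := by
  refine strictMono_nat_of_lt_succ fun n => sub_pos.mp ?_
  rw [jacobiStirlingWeight_sub]
  push_cast
  have : (0 : ℝ) ≤ n := n.cast_nonneg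
  exact mul_pos (by linarith) (by linarith)

theorem jacobiStirling_eq_sum {γ : ℝ} (hγ : 0 < γ) (n j : ℕ) :
    jacobiStirling γ n j = ∑ k ∈ Finset.range (j + 1), jacobiStirlingWeight γ k ^ n /
      ∏ i ∈ (Finset.range (j + 1)).erase k,
        (jacobiStirlingWeight γ k - jacobiStirlingWeight γ i) :=
  eq_sum_pow_div_prod_of_triangular_recurrence (jacobiStirlingWeight_strictMono hγ).injective
    (by simp [jacobiStirling]) (by simp [jacobiStirling])
    (by simp [jacobiStirling, jacobiStirlingWeight])
    (by simp [jacobiStirling, jacobiStirlingWeight]) n j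

theorem prod_jacobiStirlingWeight_sub_mul_Gamma {γ : ℝ} (hγ : 0 < γ) {j : ℕ} (hj : 1 ≤ j) :
    (∏ i ∈ Finset.range j, (jacobiStirlingWeight γ j - jacobiStirlingWeight γ i)) *
        Real.Gamma (j + 2 * γ - 1) =
      (Nat.factorial j : ℝ) * Real.Gamma (2 * j + 2 * γ - 1) := by
  have hj' : (1 : ℝ) ≤ j := by exact_mod_cast hj
  simp only [jacobiStirlingWeight_sub, Finset.prod_mul_distrib]
  rw [prod_range_cast_sub_eq_factorial, mul_assoc, Real.prod_range_add_mul_Gamma (by linarith)]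
  ring_nf

theorem tendsto_jacobiStirling_div_pow {γ : ℝ} (hγ : 0 < γ) {j : ℕ} (hj : 1 ≤ j) :
    Filter.Tendsto (fun n => jacobiStirling γ n j / jacobiStirlingWeight γ j ^ n) Filter.atTop
      (nhds (∏ i ∈ Finset.range j,
        (jacobiStirlingWeight γ j - jacobiStirlingWeight γ i))⁻¹) := by
  have hmono := jacobiStirlingWeight_strictMono hγ
  have hpos : 0 < jacobiStirlingWeight γ j := jacobiStirlingWeight_zero γ ▸ hmono hj
  simp only [jacobiStirling_eq_sum hγ, Finset.sum_div, div_right_comm _ _ (_ ^ _), ← div_pow]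
  simp only [Finset.sum_range_succ _ j, div_self hpos.ne', one_pow]
  rw [Finset.range_add_one, Finset.erase_insert Finset.notMem_range_self, ← one_div]
  nth_rewrite 2 [← zero_add (1 / _)]
  refine Filter.Tendsto.add_const _ ?_
  rw [← Finset.sum_const_zero (s := Finset.range j)]
  refine tendsto_finsetSum _ fun k hk => ?_
  have hk0 : 0 ≤ jacobiStirlingWeight γ k :=
    jacobiStirlingWeight_zero γ ▸ hmono.monotone k.zero_le
  have hlt := hmono (Finset.mem_range.mp hk)
  simpa using (tendsto_pow_atTop_nhds_zero_of_lt_one (div_nonneg hk0 hpos.le)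
    ((div_lt_one hpos).mpr hlt)).div_const _

/-- For fixed `j ≥ 1` and `γ > 0`,
`{n j}_γ ∼ Γ(j+2γ-1)/(j! Γ(2j+2γ-1)) (j(j+2γ-1))^n` as `n → ∞`. -/
theorem jacobiStirling_asymptotic (γ : ℝ) (hγ : 0 < γ) (j : ℕ) (hj : 1 ≤ j) :
    Filter.Tendsto
      (fun n : ℕ =>
        jacobiStirling γ n j * (Nat.factorial j : ℝ) * Real.Gamma (2 * j + 2 * γ - 1) /
          (Real.Gamma (j + 2 * γ - 1) * ((j : ℝ) * ((j : ℝ) + 2 * γ - 1)) ^ n))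
      Filter.atTop (nhds 1) := by
  have hj' : (1 : ℝ) ≤ j := by exact_mod_cast hj
  have hΓ : Real.Gamma (j + 2 * γ - 1) ≠ 0 := (Real.Gamma_pos_of_pos (by linarith)).ne'
  have hprod : ∏ i ∈ Finset.range j,
      (jacobiStirlingWeight γ j - jacobiStirlingWeight γ i) ≠ 0 :=
    Finset.prod_ne_zero_iff.mpr fun i hi =>
      (sub_pos.mpr (jacobiStirlingWeight_strictMono hγ (Finset.mem_range.mp hi))).ne'
  have h := (tendsto_jacobiStirling_div_pow hγ hj).mul_const
    (∏ i ∈ Finset.range j, (jacobiStirlingWeight γ j - jacobiStirlingWeight γ i))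
  rw [inv_mul_cancel₀ hprod] at h
  refine h.congr fun n => ?_
  rw [mul_assoc (jacobiStirling γ n j), ← prod_jacobiStirlingWeight_sub_mul_Gamma hγ hj,
    ← jacobiStirlingWeight, ← mul_assoc, mul_comm (Real.Gamma _) (_ ^ n),
    mul_div_mul_right _ _ hΓ, div_mul_eq_mul_div]
end

section
/- For every j ∈ ℕ₀ and every complex number t, the vertical exponential generating function identity ∑_{n=0}^∞ {n j}_{1/2} · t^{2n}/(2n)! = (2^{2j}/(2j)!) · ( sinh(t/2) )^{2j} holds, the series converging for all t ∈ ℂ. -/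
/-- The Chebyshev-Stirling numbers of the second kind `{n j}_{1/2}`, defined by the recurrence
`{n j}_{1/2} = {n-1 j-1}_{1/2} + j² {n-1 j}_{1/2}`, `{n 0}_{1/2} = δ_{n,0}`,
`{0 j}_{1/2} = δ_{0,j}`. -/
def chebyshevStirling : ℕ → ℕ → ℕ
  | 0, 0 => 1
  | 0, _ + 1 => 0
  | _ + 1, 0 => 0
  | n + 1, j + 1 => chebyshevStirling n j + (j + 1) ^ 2 * chebyshevStirling n (j + 1)

/-- The vertical exponential generating function `(2^{2j}/(2j)!) (sinh(t/2))^{2j}` of the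
Chebyshev-Stirling numbers of the second kind. -/
noncomputable def chebyshevStirlingEgf (j : ℕ) (t : ℂ) : ℂ :=
  (2 : ℂ) ^ (2 * j) / (Nat.factorial (2 * j) : ℂ) * Complex.sinh (t / 2) ^ (2 * j)

theorem contDiff_chebyshevStirlingEgf (j : ℕ) {m : WithTop ℕ∞} :
    ContDiff ℂ m (chebyshevStirlingEgf j) := by
  have h : ContDiff ℂ m fun t : ℂ => Complex.sinh (t / 2) :=
    Complex.contDiff_sinh.comp (contDiff_id.div_const 2)
  exact contDiff_const.mul (h.pow _)

theorem hasDerivAt_sinh_half (t : ℂ) :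
    HasDerivAt (fun t : ℂ => Complex.sinh (t / 2)) (Complex.cosh (t / 2) * (1 / 2)) t :=
  HasDerivAt.csinh ((hasDerivAt_id t).div_const 2)

theorem hasDerivAt_cosh_half (t : ℂ) :
    HasDerivAt (fun t : ℂ => Complex.cosh (t / 2)) (Complex.sinh (t / 2) * (1 / 2)) t :=
  HasDerivAt.ccosh ((hasDerivAt_id t).div_const 2)

theorem deriv_chebyshevStirlingEgf_succ (j : ℕ) :
    deriv (chebyshevStirlingEgf (j + 1)) = fun t =>
      (2 : ℂ) ^ (2 * (j + 1)) / (Nat.factorial (2 * (j + 1)) : ℂ) *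
        ((j + 1) * (Complex.sinh (t / 2) ^ (2 * j + 1) * Complex.cosh (t / 2))) := by
  funext t
  refine (((hasDerivAt_sinh_half t).pow (2 * (j + 1))).const_mul _).deriv.trans ?_
  rw [show 2 * (j + 1) - 1 = 2 * j + 1 by omega]
  push_cast
  ring

theorem deriv_deriv_chebyshevStirlingEgf_succ (j : ℕ) :
    deriv (deriv (chebyshevStirlingEgf (j + 1))) =
      chebyshevStirlingEgf j + fun t => ((j : ℂ) + 1) ^ 2 * chebyshevStirlingEgf (j + 1) t := by
  rw [deriv_chebyshevStirlingEgf_succ]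
  funext t
  refine (((((hasDerivAt_sinh_half t).pow (2 * j + 1)).mul
    (hasDerivAt_cosh_half t)).const_mul _).const_mul _).deriv.trans ?_
  have hfac : (Nat.factorial (2 * j) : ℂ) ≠ 0 := by exact_mod_cast Nat.factorial_ne_zero _
  have h1 : (2 * (j : ℂ) + 1) ≠ 0 := by exact_mod_cast Nat.succ_ne_zero (2 * j)
  have h2 : (2 * (j : ℂ) + 1 + 1) ≠ 0 := by exact_mod_cast Nat.succ_ne_zero (2 * j + 1)
  have hc := Complex.cosh_sq (t / 2)
  simp only [chebyshevStirlingEgf, Pi.add_apply, Pi.pow_apply, Nat.add_sub_cancel,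
    show 2 * (j + 1) = 2 * j + 1 + 1 by ring, Nat.factorial_succ]
  push_cast
  field_simp
  linear_combination
    4 * 2 ^ (2 * j) * (2 * (j : ℂ) + 1) * (j + 1) * Complex.sinh (t / 2) ^ (2 * j) * hc

theorem chebyshevStirlingEgf_zero : chebyshevStirlingEgf 0 = fun _ => 1 := by
  funext t
  simp [chebyshevStirlingEgf]

theorem iteratedDeriv_add_two_chebyshevStirlingEgf_succ (n j : ℕ) :
    iteratedDeriv (n + 2) (chebyshevStirlingEgf (j + 1)) 0 =
      iteratedDeriv n (chebyshevStirlingEgf j) 0 +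
        ((j : ℂ) + 1) ^ 2 * iteratedDeriv n (chebyshevStirlingEgf (j + 1)) 0 := by
  rw [iteratedDeriv_succ', iteratedDeriv_succ', deriv_deriv_chebyshevStirlingEgf_succ,
    iteratedDeriv_add (contDiff_chebyshevStirlingEgf j).contDiffAt
      (contDiff_const.mul (contDiff_chebyshevStirlingEgf (j + 1))).contDiffAt,
    iteratedDeriv_const_mul_field]

theorem iteratedDeriv_chebyshevStirlingEgf_even (n j : ℕ) :
    iteratedDeriv (2 * n) (chebyshevStirlingEgf j) 0 = chebyshevStirling n j := by
  induction n generalizing j with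
  | zero => cases j <;> simp [chebyshevStirlingEgf, chebyshevStirling]
  | succ n ih =>
    cases j with
    | zero => simp [chebyshevStirlingEgf_zero, iteratedDeriv_const, chebyshevStirling]
    | succ j =>
      rw [mul_add, mul_one, iteratedDeriv_add_two_chebyshevStirlingEgf_succ, ih, ih,
        chebyshevStirling]
      push_cast
      rfl

theorem iteratedDeriv_chebyshevStirlingEgf_odd (n j : ℕ) :
    iteratedDeriv (2 * n + 1) (chebyshevStirlingEgf j) 0 = 0 := by
  induction n generalizing j with
  | zero =>
    cases j with
    | zero => simp [chebyshevStirlingEgf_zero, iteratedDeriv_const]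
    | succ j => simp [deriv_chebyshevStirlingEgf_succ]
  | succ n ih =>
    cases j with
    | zero => simp [chebyshevStirlingEgf_zero, iteratedDeriv_const]
    | succ j =>
      rw [show 2 * (n + 1) + 1 = 2 * n + 1 + 2 by ring,
        iteratedDeriv_add_two_chebyshevStirlingEgf_succ, ih, ih, mul_zero, add_zero]

/-- For every `j ∈ ℕ₀` and every `t ∈ ℂ`, the series `∑_{n≥0} {n j}_{1/2} t^{2n}/(2n)!`
converges and equals `(2^{2j}/(2j)!) (sinh(t/2))^{2j}`. -/
theorem chebyshevStirling_egf (j : ℕ) (t : ℂ) :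
    HasSum
      (fun n : ℕ => (chebyshevStirling n j : ℂ) * t ^ (2 * n) / (Nat.factorial (2 * n) : ℂ))
      ((2 : ℂ) ^ (2 * j) / (Nat.factorial (2 * j) : ℂ) * Complex.sinh (t / 2) ^ (2 * j)) := by
  have hdiff : Differentiable ℂ (chebyshevStirlingEgf j) :=
    (contDiff_chebyshevStirlingEgf j (m := 1)).differentiable one_ne_zero
  have htaylor := Complex.hasSum_taylorSeries_of_entire hdiff 0 t
  have hinj : Function.Injective fun n : ℕ => 2 * n := fun a b h => by simpa using h
  rw [← hinj.hasSum_iff] at htaylor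
  · refine htaylor.congr_fun ?_
    intro n
    simp only [Function.comp_apply, iteratedDeriv_chebyshevStirlingEgf_even, sub_zero, smul_eq_mul]
    ring
  · intro m hm
    obtain ⟨k, rfl | rfl⟩ := Nat.even_or_odd' m
    · exact absurd ⟨k, rfl⟩ hm
    · simp [iteratedDeriv_chebyshevStirlingEgf_odd]
end

section
/- For every integer n ≥ 3, the finite sequence a_j := (2j)! {n j}_{1/2}, 0 ≤ j ≤ n, is unimodal with either a peak or a plateau of two points: there exists an index m with 0 ≤ m ≤ n such that a_0 < a_1 < … < a_m and a_m > a_{m+1} > … > a_n, or there exists m with a_0 < … < a_m = a_{m+1} > … > a_n. -/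
/-- The modified Chebyshev-Stirling numbers `a_j = (2j)! {n j}_{1/2}`. -/
def modCheb (n j : ℕ) : ℕ := Nat.factorial (2 * j) * chebyshevStirling n j

theorem chebyshevStirling_eq_zero_of_lt {n j : ℕ} (h : n < j) : chebyshevStirling n j = 0 := by
  induction n generalizing j with
  | zero =>
    obtain ⟨j, rfl⟩ := Nat.exists_eq_succ_of_ne_zero h.ne'
    simp [chebyshevStirling]
  | succ n ih =>
    obtain ⟨j, rfl⟩ := Nat.exists_eq_succ_of_ne_zero (Nat.ne_zero_of_lt h)
    simp [chebyshevStirling, ih (show n < j by omega), ih (show n < j + 1 by omega)]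

theorem chebyshevStirling_pos {n j : ℕ} (hj : 1 ≤ j) (h : j ≤ n) : 0 < chebyshevStirling n j := by
  induction n generalizing j with
  | zero => omega
  | succ n ih =>
    obtain ⟨j, rfl⟩ := Nat.exists_eq_add_of_le' hj
    rw [chebyshevStirling]
    rcases Nat.lt_or_ge j n with hlt | hge
    · have := ih hj hlt
      positivity
    · obtain rfl : j = n := by omega
      rcases Nat.eq_zero_or_pos j with rfl | hpos
      · simp [chebyshevStirling]
      · have := ih hpos le_rfl
        positivity

theorem modCheb_eq_zero_of_lt {n j : ℕ} (h : n < j) : modCheb n j = 0 := by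
  simp [modCheb, chebyshevStirling_eq_zero_of_lt h]

theorem modCheb_pos {n j : ℕ} (hj : 1 ≤ j) (h : j ≤ n) : 0 < modCheb n j :=
  Nat.mul_pos (Nat.factorial_pos _) (chebyshevStirling_pos hj h)

theorem modCheb_succ_zero (n : ℕ) : modCheb (n + 1) 0 = 0 := by
  simp [modCheb, chebyshevStirling]

theorem modCheb_succ_succ (n j : ℕ) :
    modCheb (n + 1) (j + 1) =
      (2 * j + 2) * (2 * j + 1) * modCheb n j + (j + 1) ^ 2 * modCheb n (j + 1) := by
  have h : (2 * (j + 1)).factorial = (2 * j + 2) * (2 * j + 1) * (2 * j).factorial := by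
    rw [show 2 * (j + 1) = 2 * j + 1 + 1 by ring, Nat.factorial_succ, Nat.factorial_succ]
    ring
  simp only [modCheb, chebyshevStirling]
  rw [mul_add, h]
  ring

/-- The coefficients of the recurrence for `modCheb` turn a log-concave window `x, y, z, w` into a
strictly log-concave triple. -/
theorem log_concave_step (k x y z w : ℕ) (hy : 0 < y) (h₁ : x * z ≤ y ^ 2) (h₂ : y * w ≤ z ^ 2)
    (h₃ : x * w ≤ y * z) :
    ((2 * k + 2) * (2 * k + 1) * x + (k + 1) ^ 2 * y) *
        ((2 * (k + 2) + 2) * (2 * (k + 2) + 1) * z + (k + 3) ^ 2 * w) <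
      ((2 * (k + 1) + 2) * (2 * (k + 1) + 1) * y + (k + 2) ^ 2 * z) ^ 2 := by
  have e₁ := Nat.mul_le_mul_left
    ((2 * k + 2) * (2 * k + 1) * ((2 * (k + 2) + 2) * (2 * (k + 2) + 1))) h₁
  have e₂ := Nat.mul_le_mul_left ((k + 1) ^ 2 * (k + 3) ^ 2) h₂
  have e₃ := Nat.mul_le_mul_left ((2 * k + 2) * (2 * k + 1) * (k + 3) ^ 2) h₃
  have p₂ : 0 ≤ k * y ^ 2 := by positivity
  have p₃ : 0 ≤ k ^ 2 * y ^ 2 := by positivity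
  have r₂ : 0 ≤ k * z ^ 2 := by positivity
  have r₃ : 0 ≤ k ^ 2 * z ^ 2 := by positivity
  nlinarith

/-- The sequence `j ↦ modCheb n j` is strictly log-concave up to index `n`. -/
theorem modCheb_mul_lt_sq {n k : ℕ} (h : k + 1 ≤ n) :
    modCheb n k * modCheb n (k + 2) < modCheb n (k + 1) ^ 2 := by
  induction n generalizing k with
  | zero => omega
  | succ n ih =>
    have weak (k : ℕ) : modCheb n k * modCheb n (k + 2) ≤ modCheb n (k + 1) ^ 2 := by
      rcases Nat.lt_or_ge n (k + 1) with hlt | hge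
      · simp [modCheb_eq_zero_of_lt (show n < k + 2 by omega)]
      · exact (ih hge).le
    rcases k with _ | k
    · have := modCheb_pos le_rfl h
      simpa [modCheb_succ_zero] using pow_pos this 2
    have hy := modCheb_pos (show 1 ≤ k + 1 by omega) (show k + 1 ≤ n by omega)
    have h₃ : modCheb n k * modCheb n (k + 3) ≤ modCheb n (k + 1) * modCheb n (k + 2) := by
      rcases Nat.lt_or_ge n (k + 2) with hlt | hge
      · simp [modCheb_eq_zero_of_lt (show n < k + 3 by omega)]
      have hz := modCheb_pos (show 1 ≤ k + 2 by omega) hge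
      refine Nat.le_of_mul_le_mul_left ?_ (Nat.mul_pos hy hz)
      calc _ = modCheb n k * modCheb n (k + 2) *
              (modCheb n (k + 1) * modCheb n (k + 3)) := by ring
        _ ≤ modCheb n (k + 1) ^ 2 * modCheb n (k + 2) ^ 2 :=
            Nat.mul_le_mul (weak k) (weak (k + 1))
        _ = _ := by ring
    rw [modCheb_succ_succ, modCheb_succ_succ, modCheb_succ_succ]
    exact log_concave_step k _ _ _ _ hy (weak k) (weak (k + 1)) h₃

/-- For `n ≥ 3`, the sequence `(2j)! {n j}_{1/2}`, `0 ≤ j ≤ n`, is unimodal with either a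
single peak or a plateau of two points. -/
theorem modCheb_unimodal (n : ℕ) (hn : 3 ≤ n) :
    (∃ m ≤ n,
      (∀ i, i < m → modCheb n i < modCheb n (i + 1)) ∧
      (∀ i, m ≤ i → i < n → modCheb n (i + 1) < modCheb n i)) ∨
    (∃ m, m + 1 ≤ n ∧
      (∀ i, i < m → modCheb n i < modCheb n (i + 1)) ∧
      modCheb n m = modCheb n (m + 1) ∧
      (∀ i, m + 1 ≤ i → i < n → modCheb n (i + 1) < modCheb n i)) := by
  have hex : ∃ i, modCheb n (i + 1) ≤ modCheb n i :=
    ⟨n, by simp [modCheb_eq_zero_of_lt (Nat.lt_succ_self n)]⟩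
  have descent : ∀ {i}, i + 1 ≤ n → modCheb n (i + 1) ≤ modCheb n i →
      modCheb n (i + 2) < modCheb n (i + 1) := by
    intro i hi hle
    have h := modCheb_mul_lt_sq hi
    by_contra! hcon
    exact absurd (Nat.mul_le_mul hle hcon) (by rw [← sq]; omega)
  have descent_from : ∀ {m}, modCheb n (m + 1) < modCheb n m →
      ∀ i, m ≤ i → i < n → modCheb n (i + 1) < modCheb n i := by
    intro m hm i hmi
    induction i, hmi using Nat.le_induction with
    | base => exact fun _ => hm
    | succ i _ ih => exact fun hi => descent hi.le (ih (by omega)).le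
  classical
  obtain ⟨m, hm, hmin⟩ : ∃ m, modCheb n (m + 1) ≤ modCheb n m ∧
      ∀ i < m, modCheb n i < modCheb n (i + 1) :=
    ⟨Nat.find hex, Nat.find_spec hex, fun i hi => not_le.mp (Nat.find_min hex hi)⟩
  have hmn : m ≤ n := by
    by_contra! hlt
    have := hmin n hlt
    simp [modCheb_eq_zero_of_lt (Nat.lt_succ_self n)] at this
  rcases hm.lt_or_eq with hlt | heq
  · exact Or.inl ⟨m, hmn, hmin, descent_from hlt⟩
  · have hm' : m + 1 ≤ n := by
      refine lt_of_le_of_ne hmn ?_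
      rintro rfl
      have := modCheb_pos (show 1 ≤ m by omega) le_rfl
      rw [modCheb_eq_zero_of_lt (Nat.lt_succ_self m)] at heq
      omega
    exact Or.inr ⟨m, hm', hmin, heq.symm, descent_from (descent hm' hm)⟩
end

section
/- There exists a constant C > 0 (one may take C = 2ζ(3/2)) such that for every integer n ≥ 2 and every real number w ≠ 0, | w^{n+1} · ∑_{m=−∞}^{∞} 1/(w + 2πi m)^{n+1} − 1 | ≤ C · ( |w|/(4π) )^{(n+1)/2}. -/
/-- AM-GM for the modulus of a complex number: `|z|² ≥ 2 |Re z| |Im z|`, for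
`z = w + 2πi m`. -/
lemma four_pi_mul_abs_mul_abs_le_norm_sq (w : ℝ) (m : ℤ) :
    4 * Real.pi * |w| * |(m : ℝ)| ≤ ‖(w : ℂ) + 2 * Real.pi * Complex.I * m‖ ^ 2 := by
  have h : ‖(w : ℂ) + 2 * Real.pi * Complex.I * m‖ ^ 2 = w ^ 2 + (2 * Real.pi * m) ^ 2 := by
    rw [← Complex.normSq_eq_norm_sq, Complex.normSq_apply]
    simp
    ring
  rw [h, ← sq_abs w, mul_pow, ← sq_abs (m : ℝ)]
  nlinarith [sq_nonneg (|w| - 2 * Real.pi * |(m : ℝ)|)]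

lemma norm_eisenstein_term_le {n : ℕ} (hn : 2 ≤ n) {w : ℝ} (hw : w ≠ 0) {m : ℤ} (hm : m ≠ 0) :
    ‖(w : ℂ) ^ (n + 1) * (1 / ((w : ℂ) + 2 * Real.pi * Complex.I * m) ^ (n + 1))‖ ≤
      (|w| / (4 * Real.pi)) ^ (((n : ℝ) + 1) / 2) * |(m : ℝ)| ^ (-(3 / 2 : ℝ)) := by
  set z : ℂ := (w : ℂ) + 2 * Real.pi * Complex.I * m
  have hw' : 0 < |w| := abs_pos.2 hw
  have hm1 : (1 : ℝ) ≤ |(m : ℝ)| := by exact_mod_cast Int.one_le_abs hm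
  have hm0 : 0 < |(m : ℝ)| := by linarith
  have hle : 4 * Real.pi * |w| * |(m : ℝ)| ≤ ‖z‖ ^ 2 := four_pi_mul_abs_mul_abs_le_norm_sq w m
  have hsq : (|w| / ‖z‖) ^ 2 ≤ |w| / (4 * Real.pi) * |(m : ℝ)|⁻¹ := by
    calc (|w| / ‖z‖) ^ 2 = |w| ^ 2 / ‖z‖ ^ 2 := div_pow _ _ _
      _ ≤ |w| ^ 2 / (4 * Real.pi * |w| * |(m : ℝ)|) := by gcongr
      _ = |w| / (4 * Real.pi) * |(m : ℝ)|⁻¹ := by field_simp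
  calc ‖(w : ℂ) ^ (n + 1) * (1 / z ^ (n + 1))‖ = (|w| / ‖z‖) ^ (n + 1) := by
        rw [mul_one_div, ← div_pow, norm_pow, norm_div, Complex.norm_real, Real.norm_eq_abs]
    _ = ((|w| / ‖z‖) ^ 2) ^ (((n : ℝ) + 1) / 2) := by
        rw [← Real.rpow_natCast_mul (by positivity), ← Real.rpow_natCast]
        congr 1
        push_cast
        ring
    _ ≤ (|w| / (4 * Real.pi) * |(m : ℝ)|⁻¹) ^ (((n : ℝ) + 1) / 2) := by gcongr
    _ = (|w| / (4 * Real.pi)) ^ (((n : ℝ) + 1) / 2) * |(m : ℝ)| ^ (-(((n : ℝ) + 1) / 2)) := by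
        rw [Real.mul_rpow (by positivity) (by positivity), Real.inv_rpow hm0.le,
          Real.rpow_neg hm0.le]
    _ ≤ _ := by
        have hn' : (2 : ℝ) ≤ n := by exact_mod_cast hn
        gcongr
        linarith

/-- There is a constant `C > 0` (one may take `C = 2ζ(3/2)`) such that for all integers
`n ≥ 2` and all real `w ≠ 0`:
`|w^{n+1} ∑_{m ∈ ℤ} (w + 2πi m)^{-(n+1)} - 1| ≤ C (|w|/(4π))^{(n+1)/2}`. -/
theorem eisenstein_series_estimate :
    ∃ C : ℝ, 0 < C ∧
      ∀ n : ℕ, 2 ≤ n → ∀ w : ℝ, w ≠ 0 →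
        ‖(w : ℂ) ^ (n + 1) *
            (∑' m : ℤ, 1 / ((w : ℂ) + 2 * Real.pi * Complex.I * m) ^ (n + 1)) - 1‖ ≤
          C * (|w| / (4 * Real.pi)) ^ (((n : ℝ) + 1) / 2) := by
  have hb : Summable fun m : ℤ => |(m : ℝ)| ^ (-(3 / 2 : ℝ)) :=
    Real.summable_abs_int_rpow (by norm_num)
  refine ⟨∑' m : ℤ, |(m : ℝ)| ^ (-(3 / 2 : ℝ)),
    hb.tsum_pos (fun m => by positivity) 1 (by simp), fun n hn w hw => ?_⟩
  set g : ℤ → ℂ := fun m =>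
    (w : ℂ) ^ (n + 1) * (1 / ((w : ℂ) + 2 * Real.pi * Complex.I * m) ^ (n + 1)) with hg
  set K : ℝ := (|w| / (4 * Real.pi)) ^ (((n : ℝ) + 1) / 2)
  have hbound (m : ℤ) : ‖g m - (Pi.single 0 1 : ℤ → ℂ) m‖ ≤ K * |(m : ℝ)| ^ (-(3 / 2 : ℝ)) := by
    rcases eq_or_ne m 0 with rfl | hm
    · have hw' : (w : ℂ) ≠ 0 := by exact_mod_cast hw
      have hg0 : g 0 = 1 := by simp [hg, hw']
      rw [hg0, Pi.single_eq_same, sub_self, norm_zero]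
      positivity
    · rw [Pi.single_eq_of_ne hm, sub_zero]
      exact norm_eisenstein_term_le hn hw hm
  have hsingle : HasSum (Pi.single 0 1 : ℤ → ℂ) 1 := hasSum_pi_single 0 1
  have hsub := Summable.of_norm_bounded (hb.mul_left K) hbound
  have hsum : Summable g := by simpa using hsub.add hsingle.summable
  rw [← tsum_mul_left, mul_comm _ K, ← tsum_mul_left]
  change ‖(∑' m, g m) - 1‖ ≤ _
  rw [← (hsum.hasSum.sub hsingle).tsum_eq]
  exact tsum_of_norm_bounded (hb.mul_left K).hasSum hbound
end

section
/- Let a_n := (n+1)/(2 log 2) − 1/2, b_n := (1 − log 2)/(2 log 2)² · (n+1) − 1/4, and c_n := √n (2 − 3 log 2)(n+1) / (2 √(b_n) log 2)³. Then, uniformly in j ∈ ℤ, (2 √(b_n) · j! · (log 2)^{n+1} / n!) · {n j} = (1/√(2π)) e^{−x²/2} ( 1 + c_n (x³ − 3x)/(6√n) ) + o(1/√n) as n → ∞, where x = (j − a_n)/√(b_n). Equivalently: √n · sup_{j ∈ ℤ} | (2 √(b_n) j! (log 2)^{n+1}/n!) {n j} − (1/√(2π)) e^{−x_j²/2} ( 1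 + c_n (x_j³ − 3x_j)/(6√n) ) | → 0 as n → ∞, with x_j := (j − a_n)/√(b_n). -/
/-- The classical Stirling numbers of the second kind `{n j}`, defined by the recurrence
`{n j} = {n-1 j-1} + j {n-1 j}`, `{n 0} = δ_{n,0}`, `{0 j} = δ_{0,j}`
(and `{n j} = 0` for integers `j < 0`, which is captured below by the `if`). -/
def stirling2 : ℕ → ℕ → ℕ
  | 0, 0 => 1
  | 0, _ + 1 => 0
  | _ + 1, 0 => 0
  | n + 1, j + 1 => stirling2 n j + (j + 1) * stirling2 n (j + 1)

/-- `a_n = (n+1)/(2 log 2) - 1/2`. -/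
noncomputable def a (n : ℕ) : ℝ := ((n : ℝ) + 1) / (2 * Real.log 2) - 1 / 2

/-- `b_n = (1 - log 2)/(2 log 2)² (n+1) - 1/4`. -/
noncomputable def b (n : ℕ) : ℝ :=
  (1 - Real.log 2) / (2 * Real.log 2) ^ 2 * ((n : ℝ) + 1) - 1 / 4

/-- `c_n = √n (2 - 3 log 2)(n+1) / (2 √(b_n) log 2)³`. -/
noncomputable def c (n : ℕ) : ℝ :=
  Real.sqrt n * (2 - 3 * Real.log 2) * ((n : ℝ) + 1) /
    (2 * Real.sqrt (b n) * Real.log 2) ^ 3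

/-- `x = (j - a_n)/√(b_n)`. -/
noncomputable def x (n : ℕ) (j : ℤ) : ℝ := ((j : ℝ) - a n) / Real.sqrt (b n)

/-- The normalized Stirling quantity `2 √(b_n) j! (log 2)^{n+1} {n j} / n!`
(equal to `0` for integers `j < 0`, since then `{n j} = 0`). -/
noncomputable def normalizedStirling (n : ℕ) (j : ℤ) : ℝ :=
  if 0 ≤ j then
    2 * Real.sqrt (b n) * (Nat.factorial j.toNat : ℝ) * Real.log 2 ^ (n + 1) /
      (Nat.factorial n : ℝ) * (stirling2 n j.toNat : ℝ)
  else 0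

/-- The number `j! {n j}` of surjections from an `n`-element set onto a `j`-element set. -/
def surj (n j : ℕ) : ℕ := Nat.factorial j * stirling2 n j

lemma surj_zero_zero : surj 0 0 = 1 := by simp [surj, stirling2]

lemma surj_zero_succ (j : ℕ) : surj 0 (j + 1) = 0 := by simp [surj, stirling2]

lemma surj_succ_zero (n : ℕ) : surj (n + 1) 0 = 0 := by simp [surj, stirling2]

lemma surj_succ_succ (n j : ℕ) :
    surj (n + 1) (j + 1) = (j + 1) * (surj n j + surj n (j + 1)) := by
  simp only [surj, stirling2, Nat.factorial_succ]
  ring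

lemma surj_eq_zero_of_lt {n j : ℕ} (h : n < j) : surj n j = 0 := by
  induction n generalizing j with
  | zero =>
    obtain ⟨j, rfl⟩ := Nat.exists_eq_succ_of_ne_zero h.ne'
    exact surj_zero_succ j
  | succ n ih =>
    obtain ⟨j, rfl⟩ := Nat.exists_eq_succ_of_ne_zero (Nat.ne_zero_of_lt h)
    rw [Nat.succ_eq_add_one, surj_succ_succ, ih (by omega), ih (by omega), add_zero, mul_zero]

lemma sum_choose_succ_mul (n : ℕ) (f : ℕ → ℕ) :
    ∑ k ∈ Finset.range (n + 2), (n + 1).choose k * f k =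
      ∑ k ∈ Finset.range (n + 1), n.choose k * f k +
        ∑ k ∈ Finset.range (n + 1), n.choose k * f (k + 1) := by
  rw [Finset.sum_range_succ', Finset.sum_congr rfl fun k _ => by
    rw [Nat.choose_succ_succ, add_mul], Finset.sum_add_distrib,
    Finset.sum_range_succ (fun k => n.choose (k + 1) * f (k + 1)), Finset.sum_range_succ'
      (fun k => n.choose k * f k) n]
  simp
  ring

/-- Splitting off the fibre over one point of the target. -/
lemma sum_choose_mul_surj (n j : ℕ) :
    ∑ k ∈ Finset.range (n + 1), n.choose k * surj k j = surj n j + surj n (j + 1) := by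
  induction n generalizing j with
  | zero => simp [surj_zero_succ]
  | succ n ih =>
    rw [sum_choose_succ_mul, ih]
    cases j with
    | zero => simp [surj_succ_zero, surj_succ_succ]
    | succ j =>
      have h : ∀ k ∈ Finset.range (n + 1), n.choose k * surj (k + 1) (j + 1) =
          (j + 1) * (n.choose k * surj k j + n.choose k * surj k (j + 1)) := fun k _ => by
        rw [surj_succ_succ]; ring
      rw [Finset.sum_congr rfl h, ← Finset.mul_sum, Finset.sum_add_distrib, ih, ih,
        surj_succ_succ, surj_succ_succ]
      ring

lemma surj_succ_right (n j : ℕ) :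
    surj n (j + 1) = ∑ k ∈ Finset.range n, n.choose k * surj k j := by
  have h := sum_choose_mul_surj n j
  rw [Finset.sum_range_succ, Nat.choose_self, one_mul] at h
  omega

/-- The generating polynomial `∑ j! {n j} z^j`. -/
noncomputable def fubini (n : ℕ) (z : ℂ) : ℂ :=
  ∑ j ∈ Finset.range (n + 1), (surj n j : ℂ) * z ^ j

lemma fubini_zero (z : ℂ) : fubini 0 z = 1 := by simp [fubini, surj_zero_zero]

lemma fubini_eq_sum {n m : ℕ} (h : n < m) (z : ℂ) :
    fubini n z = ∑ j ∈ Finset.range m, (surj n j : ℂ) * z ^ j := by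
  refine Finset.sum_subset (by simpa using h) fun j _ hj => ?_
  rw [surj_eq_zero_of_lt (by simpa using hj)]
  simp

lemma fubini_eq {n : ℕ} (hn : n ≠ 0) (z : ℂ) :
    fubini n z = z * ∑ k ∈ Finset.range n, (n.choose k : ℂ) * fubini k z := by
  have h0 : surj n 0 = 0 := by
    obtain ⟨m, rfl⟩ := Nat.exists_eq_succ_of_ne_zero hn
    exact surj_succ_zero m
  have h : ∀ k ∈ Finset.range n, (n.choose k : ℂ) * fubini k z =
      ∑ j ∈ Finset.range n, (n.choose k : ℂ) * ((surj k j : ℂ) * z ^ j) := fun k hk => by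
    rw [fubini_eq_sum (Finset.mem_range.1 hk), Finset.mul_sum]
  rw [Finset.sum_congr rfl h, Finset.sum_comm, fubini, Finset.sum_range_succ', h0, Finset.mul_sum]
  simp only [Nat.cast_zero, zero_mul, add_zero]
  refine Finset.sum_congr rfl fun j _ => ?_
  rw [surj_succ_right, Nat.cast_sum, Finset.sum_mul, Finset.mul_sum]
  refine Finset.sum_congr rfl fun k _ => ?_
  push_cast
  ring

/-- The sum `∑ m^n q^m` is a rational function of `q` whose numerator is a Fubini polynomial. -/
lemma fubini_eq_tsum {q z : ℂ} (hq : ‖q‖ < 1) (hz : q = z * (1 - q)) (n : ℕ) :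
    fubini n z = (1 - q) * ∑' m : ℕ, (m : ℂ) ^ n * q ^ m := by
  have hsum : ∀ k : ℕ, Summable fun m : ℕ => (m : ℂ) ^ k * q ^ m := fun k =>
    summable_pow_mul_geometric_of_norm_lt_one k hq
  have hq1 : 1 - q ≠ 0 := by
    intro h
    rw [sub_eq_zero] at h
    simp [← h] at hq
  induction n using Nat.strong_induction_on with
  | _ n ih =>
    rcases eq_or_ne n 0 with rfl | hn
    · simp [fubini_zero, tsum_geometric_of_norm_lt_one hq, hq1]
    rw [fubini_eq hn, Finset.sum_congr rfl fun k hk => by rw [ih k (Finset.mem_range.1 hk)]]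
    set g : ℕ → ℂ := fun k => ∑' m : ℕ, (m : ℂ) ^ k * q ^ m with hg
    have hshift : g n = q * ∑' m : ℕ, ((m : ℂ) + 1) ^ n * q ^ m := by
      simp only [hg]
      rw [(hsum n).tsum_eq_zero_add, ← tsum_mul_left]
      simp only [Nat.cast_zero, zero_pow hn, zero_mul, zero_add]
      refine tsum_congr fun m => ?_
      push_cast
      ring
    have hbin : ∑' m : ℕ, ((m : ℂ) + 1) ^ n * q ^ m =
        ∑ k ∈ Finset.range (n + 1), (n.choose k : ℂ) * g k := by
      simp only [hg, ← tsum_mul_left]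
      rw [← Summable.tsum_finsetSum fun k _ => (hsum k).mul_left _]
      refine tsum_congr fun m => ?_
      rw [add_pow, Finset.sum_mul]
      refine Finset.sum_congr rfl fun k _ => ?_
      simp
      ring
    rw [hbin, Finset.sum_range_succ, Nat.choose_self, Nat.cast_one, one_mul] at hshift
    have hs : ∑ k ∈ Finset.range n, (n.choose k : ℂ) * ((1 - q) * g k) =
        (1 - q) * ∑ k ∈ Finset.range n, (n.choose k : ℂ) * g k := by
      rw [Finset.mul_sum]
      exact Finset.sum_congr rfl fun k _ => by ring
    change z * ∑ k ∈ Finset.range n, (n.choose k : ℂ) * ((1 - q) * g k) = (1 - q) * g n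
    rw [hs]
    linear_combination (-∑ k ∈ Finset.range n, (n.choose k : ℂ) * g k) * hz - hshift

lemma norm_half_add_exp_le {δ θ : ℝ} (hδ : 0 ≤ δ) (h : δ ≤ |θ|) (hπ : |θ| ≤ Real.pi) :
    ‖(1 / 2 : ℂ) + Complex.exp (θ * Complex.I)‖ ≤ Real.sqrt (5 / 4 + Real.cos δ) := by
  refine Real.le_sqrt_of_sq_le ?_
  have hcos : Real.cos θ ≤ Real.cos δ := by
    rw [← Real.cos_abs θ]
    exact Real.cos_le_cos_of_nonneg_of_le_pi hδ hπ h
  rw [Complex.sq_norm, Complex.normSq_apply, Complex.exp_mul_I, ← Complex.ofReal_cos,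
    ← Complex.ofReal_sin]
  simp only [Complex.add_re, Complex.add_im, Complex.mul_re, Complex.mul_im, Complex.ofReal_re,
    Complex.ofReal_im, Complex.I_re, Complex.I_im, Complex.div_ofNat_re, Complex.div_ofNat_im,
    Complex.one_re, Complex.one_im]
  nlinarith [Real.sin_sq_add_cos_sq θ]

/-- The probability that the renewal process whose steps have the law of a zero-truncated Poisson
variable with parameter `log 2` renews at time `n`, with the number of renewals marked by `z`. -/
noncomputable def renewal (n : ℕ) (z : ℂ) : ℂ :=
  fubini n z * (Real.log 2 ^ n / (n.factorial : ℝ) : ℝ)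

lemma renewal_zero (z : ℂ) : renewal 0 z = 1 := by simp [renewal, fubini_zero]

lemma renewal_eq {n : ℕ} (hn : n ≠ 0) (z : ℂ) :
    renewal n z = z * ∑ k ∈ Finset.range n,
      (Real.log 2 ^ (n - k) / ((n - k).factorial : ℝ) : ℝ) * renewal k z := by
  rw [renewal, fubini_eq hn, mul_assoc, Finset.sum_mul]
  congr 1
  refine Finset.sum_congr rfl fun k hk => ?_
  have hk : k ≤ n := (Finset.mem_range.1 hk).le
  rw [renewal, Nat.cast_choose ℂ hk]
  have h1 : (n.factorial : ℂ) ≠ 0 := by exact_mod_cast n.factorial_ne_zero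
  have h2 : (k.factorial : ℂ) ≠ 0 := by exact_mod_cast k.factorial_ne_zero
  have h3 : ((n - k).factorial : ℂ) ≠ 0 := by exact_mod_cast (n - k).factorial_ne_zero
  have h4 : (Real.log 2 : ℂ) ^ n = (Real.log 2 : ℂ) ^ (n - k) * (Real.log 2 : ℂ) ^ k := by
    rw [← pow_add, Nat.sub_add_cancel hk]
  push_cast
  rw [h4]
  field_simp

lemma sum_range_pow_div_factorial_tail_le {y : ℝ} (hy : 0 ≤ y) (n m : ℕ) :
    ∑ i ∈ Finset.range n, y ^ (i + m) / ((i + m).factorial : ℝ) ≤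
      Real.exp y - ∑ i ∈ Finset.range m, y ^ i / (i.factorial : ℝ) := by
  have h := Real.sum_le_exp_of_nonneg hy (m + n)
  rw [Finset.sum_range_add] at h
  simp only [add_comm m] at h
  linarith

/-- Two steps of the renewal equation. -/
lemma renewal_add_two (n : ℕ) (z : ℂ) :
    renewal (n + 2) z = z *
      (∑ k ∈ Finset.range n,
        (Real.log 2 ^ (n + 2 - k) / ((n + 2 - k).factorial : ℝ) : ℝ) * renewal k z +
      z * Real.log 2 * ∑ k ∈ Finset.range n,
        (Real.log 2 ^ (n + 1 - k) / ((n + 1 - k).factorial : ℝ) : ℝ) * renewal k z +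
      Real.log 2 ^ 2 * (1 / 2 + z) * renewal n z) := by
  have h1 : n + 2 - (n + 1) = 1 := by omega
  have h2 : n + 2 - n = 2 := by omega
  have h3 : n + 1 - n = 1 := by omega
  rw [renewal_eq (by omega), Finset.sum_range_succ, Finset.sum_range_succ,
    renewal_eq (n := n + 1) (by omega), Finset.sum_range_succ, h1, h2, h3]
  norm_num
  exact Or.inl (by ring)

lemma sum_mul_renewal_le {r C : ℝ} (hr : 0 < r) {z : ℂ} {n : ℕ}
    (h : ∀ k < n, ‖renewal k z‖ * r ^ k ≤ C) (m : ℕ) (hC : 0 ≤ C) :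
    ‖∑ k ∈ Finset.range n,
      (Real.log 2 ^ (n + m - k) / ((n + m - k).factorial : ℝ) : ℝ) * renewal k z‖ * r ^ (n + m) ≤
      C * (Real.exp (r * Real.log 2) -
        ∑ i ∈ Finset.range (m + 1), (r * Real.log 2) ^ i / (i.factorial : ℝ)) := by
  have hL : 0 < Real.log 2 := Real.log_pos one_lt_two
  calc _ ≤ (∑ k ∈ Finset.range n,
        Real.log 2 ^ (n + m - k) / ((n + m - k).factorial : ℝ) * ‖renewal k z‖) * r ^ (n + m) := by
        gcongr
        refine (norm_sum_le _ _).trans_eq (Finset.sum_congr rfl fun k _ => ?_)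
        rw [norm_mul, Complex.norm_real, Real.norm_of_nonneg (by positivity)]
    _ ≤ ∑ k ∈ Finset.range n,
        C * ((r * Real.log 2) ^ (n + m - k) / ((n + m - k).factorial : ℝ)) := by
        rw [Finset.sum_mul]
        refine Finset.sum_le_sum fun k hk => ?_
        have hk := Finset.mem_range.1 hk
        have hp : r ^ (n + m) = r ^ (n + m - k) * r ^ k := by
          rw [← pow_add, Nat.sub_add_cancel (by omega)]
        rw [hp, mul_pow]
        calc _ = (‖renewal k z‖ * r ^ k) * (r ^ (n + m - k) * Real.log 2 ^ (n + m - k) /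
              ((n + m - k).factorial : ℝ)) := by ring
          _ ≤ _ := by gcongr; exact h k hk
    _ = C * ∑ i ∈ Finset.range n,
        (r * Real.log 2) ^ (i + (m + 1)) / ((i + (m + 1)).factorial : ℝ) := by
        rw [← Finset.mul_sum, ← Finset.sum_range_reflect]
        congr 1
        refine Finset.sum_congr rfl fun k hk => ?_
        have hk := Finset.mem_range.1 hk
        rw [show n + m - (n - 1 - k) = k + (m + 1) by omega]
    _ ≤ _ := by
        gcongr
        exact sum_range_pow_div_factorial_tail_le (by positivity) n (m + 1)

/-- Away from `z = 1`, the renewal sequence decays exponentially, uniformly on the unit circle. -/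
lemma exists_norm_renewal_le {δ : ℝ} (hδ : 0 < δ) (hδπ : δ ≤ Real.pi) :
    ∃ r > (1 : ℝ), ∃ C > (0 : ℝ), ∀ (n : ℕ) (θ : ℝ), δ ≤ |θ| → |θ| ≤ Real.pi →
      ‖renewal n (Complex.exp (θ * Complex.I))‖ * r ^ n ≤ C := by
  set L := Real.log 2 with hLdef
  have hL : 0 < L := Real.log_pos one_lt_two
  set K := Real.sqrt (5 / 4 + Real.cos δ) with hK
  have hK32 : K < 3 / 2 := by
    rw [hK, Real.sqrt_lt' (by norm_num)]
    have := Real.cos_lt_cos_of_nonneg_of_le_pi le_rfl hδπ hδ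
    rw [Real.cos_zero] at this
    linarith
  let T : ℝ → ℝ := fun r => (Real.exp (r * L) - (1 + r * L + (r * L) ^ 2 / 2)) +
    L * r * (Real.exp (r * L) - (1 + r * L)) + L ^ 2 * K * r ^ 2
  have hT1 : T 1 < 1 := by
    have : Real.exp L = 2 := Real.exp_log two_pos
    simp only [T, one_mul, this]
    nlinarith [mul_pos hL hL]
  have hTc : Continuous T := by fun_prop
  obtain ⟨r, hr1, hTr⟩ : ∃ r > (1 : ℝ), T r < 1 := by
    have h := (hTc.tendsto 1).eventually_lt_const hT1
    have h2 : ∀ᶠ r in nhdsWithin (1 : ℝ) (Set.Ioi 1), T r < 1 := h.filter_mono nhdsWithin_le_nhds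
    obtain ⟨r, h3, h4⟩ := (h2.and self_mem_nhdsWithin).exists
    exact ⟨r, h4, h3⟩
  have hr0 : 0 < r := by linarith
  refine ⟨r, hr1, 1 + L * r, by positivity, fun n θ h1 h2 => ?_⟩
  set z := Complex.exp (θ * Complex.I) with hz
  have hz1 : ‖z‖ = 1 := Complex.norm_exp_ofReal_mul_I θ
  induction n using Nat.strong_induction_on with
  | _ n ih =>
    match n, ih with
    | 0, _ =>
      simp only [renewal_zero, norm_one, pow_zero, mul_one]
      nlinarith [mul_pos hL hr0]
    | 1, _ =>
      rw [renewal_eq one_ne_zero]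
      simp [renewal_zero, hz1, abs_of_pos hL, ← hLdef]
    | n + 2, ih =>
      have hC : 0 ≤ 1 + L * r := by positivity
      have hA := sum_mul_renewal_le hr0 (fun k hk => ih k (by omega)) 2 hC (n := n)
      have hB := sum_mul_renewal_le hr0 (fun k hk => ih k (by omega)) 1 hC (n := n)
      have hn := ih n (by omega)
      have hKz : ‖1 / 2 + z‖ ≤ K := norm_half_add_exp_le hδ.le h1 h2
      rw [renewal_add_two]
      simp only [Finset.sum_range_succ, Finset.sum_range_zero, Nat.factorial, ← hLdef] at hA hB ⊢
      norm_num at hA hB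
      set A := ∑ k ∈ Finset.range n,
        (L ^ (n + 2 - k) / ((n + 2 - k).factorial : ℝ) : ℝ) * renewal k z with hAdef
      set B := ∑ k ∈ Finset.range n,
        (L ^ (n + 1 - k) / ((n + 1 - k).factorial : ℝ) : ℝ) * renewal k z with hBdef
      have hA' : ‖A‖ * r ^ (n + 2) ≤ (1 + L * r) *
        (Real.exp (r * L) - (1 + r * L + (r * L) ^ 2 / 2)) := by
        rw [hAdef]; push_cast; exact hA
      have hB' : ‖B‖ * r ^ (n + 1) ≤ (1 + L * r) * (Real.exp (r * L) - (1 + r * L)) := by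
        rw [hBdef]; push_cast; exact hB
      have hnorm : ‖z * (A + z * L * B + L ^ 2 * (1 / 2 + z) * renewal n z)‖ ≤
          ‖A‖ + L * ‖B‖ + L ^ 2 * K * ‖renewal n z‖ := by
        rw [norm_mul, hz1, one_mul]
        refine norm_add₃_le.trans ?_
        simp only [norm_mul, hz1, norm_pow, Complex.norm_real, Real.norm_of_nonneg hL.le, one_mul]
        gcongr
      calc _ ≤ (‖A‖ + L * ‖B‖ + L ^ 2 * K * ‖renewal n z‖) * r ^ (n + 2) := by gcongr
        _ = ‖A‖ * r ^ (n + 2) + L * r * (‖B‖ * r ^ (n + 1)) +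
            L ^ 2 * K * r ^ 2 * (‖renewal n z‖ * r ^ n) := by ring
        _ ≤ (1 + L * r) * (Real.exp (r * L) - (1 + r * L + (r * L) ^ 2 / 2)) +
            L * r * ((1 + L * r) * (Real.exp (r * L) - (1 + r * L))) +
            L ^ 2 * K * r ^ 2 * (1 + L * r) := by gcongr
        _ = (1 + L * r) * T r := by simp only [T]; ring
        _ ≤ 1 + L * r := mul_le_of_le_one_right hC hTr.le

/-- Partial fraction expansion of the Fubini polynomials over the poles of their generating
function. -/
lemma fubini_eq_tsum_poles {t z : ℂ} (ht : 0 < t.re)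
    (hz : Complex.exp (-t) = z * (1 - Complex.exp (-t))) {n : ℕ} (hn : 1 ≤ n) :
    fubini n z = (1 - Complex.exp (-t)) * n.factorial *
      ∑' d : ℤ, 1 / (t - 2 * Real.pi * Complex.I * d) ^ (n + 1) := by
  have hq : ‖Complex.exp (-t)‖ < 1 := by
    rw [Complex.norm_exp, Real.exp_lt_one_iff]
    simpa using ht
  have hpi : (Real.pi : ℂ) ≠ 0 := by exact_mod_cast Real.pi_ne_zero
  have him : 0 < (Complex.I * t / (2 * Real.pi)).im := by
    have : Complex.I * t / (2 * Real.pi) = Complex.I * t / ((2 * Real.pi : ℝ) : ℂ) := by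
      push_cast; rfl
    rw [this, Complex.div_ofReal_im]
    have : 0 < (Complex.I * t).im := by simpa using ht
    positivity
  have key := EisensteinSeries.qExpansion_identity hn ⟨Complex.I * t / (2 * Real.pi), him⟩
  have h1 : ∀ d : ℤ, 1 / (Complex.I * t / (2 * Real.pi) + (d : ℂ)) ^ (n + 1) =
      (-2 * Real.pi * Complex.I) ^ (n + 1) *
        (1 / (t - 2 * Real.pi * Complex.I * d) ^ (n + 1)) := fun d => by
    have h2 : Complex.I * t / (2 * Real.pi) + (d : ℂ) =
        (t - 2 * Real.pi * Complex.I * d) / (-2 * Real.pi * Complex.I) := by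
      have := Complex.I_ne_zero
      field_simp
      linear_combination t * Complex.I_sq
    rw [h2, div_pow, one_div_div, mul_one_div]
  have h3 : 2 * Real.pi * Complex.I * (Complex.I * t / (2 * Real.pi)) = -t := by
    field_simp
    linear_combination t * Complex.I_sq
  have hc : (-2 * Real.pi * Complex.I) ^ (n + 1) ≠ 0 := by simp [hpi]
  have hf : (n.factorial : ℂ) ≠ 0 := by exact_mod_cast n.factorial_ne_zero
  change ∑' d : ℤ, 1 / (Complex.I * t / (2 * Real.pi) + (d : ℂ)) ^ (n + 1) =
    ((-2 * Real.pi * Complex.I) ^ (n + 1) / n.factorial) * ∑' m : ℕ, (m : ℂ) ^ n *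
      Complex.exp (2 * Real.pi * Complex.I * (Complex.I * t / (2 * Real.pi))) ^ m at key
  rw [tsum_congr h1, tsum_mul_left, h3, div_mul_eq_mul_div, mul_div_assoc] at key
  rw [fubini_eq_tsum hq hz, mul_left_cancel₀ hc key]
  field_simp

/-- The pole `log (1 + e^{-iθ})` closest to the origin. -/
noncomputable def pole (θ : ℝ) : ℂ :=
  (Real.log 2 + Real.log (Real.cos (θ / 2)) : ℝ) - (θ / 2 : ℝ) * Complex.I

lemma cos_half_ge {θ : ℝ} (hθ : |θ| ≤ 1) : 7 / 8 ≤ Real.cos (θ / 2) := by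
  have h := Real.one_sub_sq_div_two_le_cos (x := θ / 2)
  have : θ ^ 2 ≤ 1 := (sq_le_one_iff_abs_le_one θ).2 hθ
  linarith

lemma pole_re (θ : ℝ) : (pole θ).re = Real.log 2 + Real.log (Real.cos (θ / 2)) := by
  rw [pole, Complex.sub_re, Complex.ofReal_re, Complex.re_ofReal_mul, Complex.I_re, mul_zero,
    sub_zero]

lemma pole_im (θ : ℝ) : (pole θ).im = -(θ / 2) := by
  rw [pole, Complex.sub_im, Complex.ofReal_im, Complex.im_ofReal_mul, Complex.I_im, mul_one,
    zero_sub]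

lemma pole_re_pos {θ : ℝ} (hθ : |θ| ≤ 1) : 0 < (pole θ).re := by
  have h := cos_half_ge hθ
  have h1 : (pole θ).re = Real.log (2 * Real.cos (θ / 2)) := by
    rw [Real.log_mul two_ne_zero (by linarith), pole_re]
  rw [h1]
  exact Real.log_pos (by linarith)

lemma exp_neg_pole {θ : ℝ} (hθ : |θ| ≤ 1) :
    Complex.exp (-pole θ) =
      Complex.exp ((θ / 2 : ℝ) * Complex.I) / (2 * Real.cos (θ / 2) : ℝ) := by
  have h := cos_half_ge hθ
  rw [← Real.exp_log (show 0 < 2 * Real.cos (θ / 2) by linarith),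
    Real.log_mul two_ne_zero (by linarith), Complex.ofReal_exp, ← Complex.exp_sub, pole]
  congr 1
  ring

lemma one_sub_exp_neg_pole {θ : ℝ} (hθ : |θ| ≤ 1) :
    1 - Complex.exp (-pole θ) =
      Complex.exp (-((θ / 2 : ℝ) * Complex.I)) / (2 * Real.cos (θ / 2) : ℝ) := by
  have h := cos_half_ge hθ
  have h0 : (Real.cos (θ / 2) : ℂ) ≠ 0 := by
    exact_mod_cast (show Real.cos (θ / 2) ≠ 0 by linarith)
  rw [exp_neg_pole hθ, eq_div_iff (by push_cast at h0 ⊢; simpa using h0), sub_mul,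
    div_mul_cancel₀ _ (by push_cast at h0 ⊢; simpa using h0), ← neg_mul, Complex.exp_mul_I,
    Complex.exp_mul_I, Complex.cos_neg, Complex.sin_neg]
  push_cast
  ring

lemma five_mul_le_norm_pole_sub {θ : ℝ} (hθ : |θ| ≤ 1) (d : ℤ) (hd : d ≠ 0) :
    5 * |(d : ℝ)| ≤ ‖pole θ - 2 * Real.pi * Complex.I * d‖ := by
  have h1 : (1 : ℝ) ≤ |(d : ℝ)| := by exact_mod_cast Int.one_le_abs hd
  have h2 : (pole θ - 2 * Real.pi * Complex.I * d).im = -(2 * Real.pi * d + θ / 2) := by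
    rw [Complex.sub_im, pole_im]
    simp
    ring
  have h3 := Complex.abs_im_le_norm (pole θ - 2 * Real.pi * Complex.I * d)
  rw [h2, abs_neg] at h3
  have h4 : 2 * Real.pi * |(d : ℝ)| - |θ / 2| ≤ |2 * Real.pi * d + θ / 2| := by
    have := abs_sub_abs_le_abs_sub (2 * Real.pi * d) (-(θ / 2))
    rwa [abs_neg, sub_neg_eq_add, abs_mul, abs_of_pos Real.two_pi_pos] at this
  rw [abs_div, abs_two] at h4
  nlinarith [Real.pi_gt_three]

/-- The contribution of the closest pole to the characteristic function. -/
noncomputable def mainTerm (n : ℕ) (θ : ℝ) : ℂ :=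
  Complex.exp (-((θ / 2 : ℝ) * Complex.I)) / (Real.cos (θ / 2) : ℝ) *
    (Real.log 2 / pole θ) ^ (n + 1)

lemma exists_norm_renewal_sub_mainTerm_le :
    ∃ C > (0 : ℝ), ∀ (n : ℕ) (θ : ℝ), 1 ≤ n → |θ| ≤ 1 →
      ‖2 * Real.log 2 * renewal n (Complex.exp (θ * Complex.I)) - mainTerm n θ‖ * 5 ^ n ≤ C := by
  have hS : Summable fun d : ℤ => 1 / (d : ℝ) ^ 2 := Real.summable_one_div_int_pow.2 one_lt_two
  have hL : 0 < Real.log 2 := Real.log_pos one_lt_two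
  have hL1 : Real.log 2 ≤ 1 := by linarith [Real.log_two_lt_d9]
  set S := ∑' d : ℤ, 1 / (d : ℝ) ^ 2
  have hS0 : 0 ≤ S := tsum_nonneg fun d => by positivity
  refine ⟨2 * S + 1, by positivity, fun n θ hn hθ => ?_⟩
  have hcos := cos_half_ge hθ
  have hcos0 : (Real.cos (θ / 2) : ℂ) ≠ 0 := by
    exact_mod_cast (show Real.cos (θ / 2) ≠ 0 by linarith)
  set f : ℤ → ℂ := fun d => 1 / (pole θ - 2 * Real.pi * Complex.I * d) ^ (n + 1) with hf
  set g : ℤ → ℂ := fun d => if d = 0 then 0 else f d with hg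
  have hgb : ∀ d, ‖g d‖ ≤ (1 / 5 ^ n) * (1 / (d : ℝ) ^ 2) := fun d => by
    rcases eq_or_ne d 0 with rfl | hd
    · simp [hg]
    simp only [hg, hd, if_false, hf, norm_div, norm_one, norm_pow]
    have h1 : (1 : ℝ) ≤ |(d : ℝ)| := by exact_mod_cast Int.one_le_abs hd
    have h2 : 1 / 5 ^ n * (1 / (d : ℝ) ^ 2) = 1 / (|(d : ℝ)| ^ 2 * 5 ^ n) := by
      rw [sq_abs, one_div_mul_one_div_rev]
    rw [h2]
    refine one_div_le_one_div_of_le (by positivity) ?_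
    calc |(d : ℝ)| ^ 2 * 5 ^ n ≤ |(d : ℝ)| ^ (n + 1) * 5 ^ (n + 1) := by
          gcongr
          · omega
          · norm_num
          · omega
      _ = (5 * |(d : ℝ)|) ^ (n + 1) := by rw [mul_pow, mul_comm]
      _ ≤ _ := by gcongr; exact five_mul_le_norm_pole_sub hθ d hd
  have hgs : Summable g := Summable.of_norm_bounded (hS.mul_left _) hgb
  have hgn : ‖∑' d, g d‖ ≤ 1 / 5 ^ n * S := by
    rw [← tsum_mul_left]
    exact tsum_of_norm_bounded (hS.mul_left _).hasSum hgb
  have hfg : ∑' d, f d = 1 / pole θ ^ (n + 1) + ∑' d, g d := by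
    have h0 : HasSum (fun d : ℤ => if d = 0 then f 0 else 0) (f 0) := hasSum_ite_eq 0 (f 0)
    have h1 : f = fun d => (if d = 0 then f 0 else 0) + g d := by
      funext d
      by_cases hd : d = 0 <;> simp [hg, hd]
    rw [h1, (h0.add hgs.hasSum).tsum_eq]
    simp [hf]
  have hz : Complex.exp (-pole θ) =
      Complex.exp (θ * Complex.I) * (1 - Complex.exp (-pole θ)) := by
    rw [one_sub_exp_neg_pole hθ, exp_neg_pole hθ, ← mul_div_assoc, ← Complex.exp_add]
    congr 2
    push_cast
    ring
  have hmain : 2 * Real.log 2 * renewal n (Complex.exp (θ * Complex.I)) - mainTerm n θ =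
      Complex.exp (-((θ / 2 : ℝ) * Complex.I)) / (Real.cos (θ / 2) : ℝ) *
        (Real.log 2 : ℂ) ^ (n + 1) * ∑' d, g d := by
    rw [renewal, fubini_eq_tsum_poles (pole_re_pos hθ) hz hn, one_sub_exp_neg_pole hθ]
    change 2 * Real.log 2 * (_ * _ * (∑' d, f d) * _) - _ = _
    have hfac : (n.factorial : ℂ) ≠ 0 := by exact_mod_cast n.factorial_ne_zero
    rw [hfg, mainTerm, div_pow]
    generalize ∑' d, g d = s
    push_cast at hcos0 ⊢
    field_simp
    ring
  have hexp : ‖Complex.exp (-((θ / 2 : ℝ) * Complex.I))‖ = 1 := by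
    rw [← neg_mul, ← Complex.ofReal_neg, Complex.norm_exp_ofReal_mul_I]
  rw [hmain, norm_mul, norm_mul, norm_div, hexp, norm_pow, Complex.norm_real, Complex.norm_real,
    Real.norm_of_nonneg hL.le, Real.norm_of_nonneg (by linarith)]
  have h1 : 1 / Real.cos (θ / 2) ≤ 2 := by
    rw [div_le_iff₀ (by linarith)]
    linarith
  have h2 : Real.log 2 ^ (n + 1) ≤ 1 := pow_le_one₀ hL.le hL1
  calc _ ≤ 2 * 1 * (1 / 5 ^ n * S) * 5 ^ n := by
        gcongr
    _ = 2 * S := by field_simp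
    _ ≤ _ := by linarith

lemma abs_log_cos_half_add_le {θ : ℝ} (hθ : |θ| ≤ 1) :
    |Real.log (Real.cos (θ / 2)) + θ ^ 2 / 8| ≤ θ ^ 4 / 8 := by
  have h1 : |θ / 2| ≤ 1 := by rw [abs_div, abs_two]; linarith
  have h2 := Real.cos_bound h1
  have hcos := cos_half_ge hθ
  have hcos1 := Real.cos_le_one (θ / 2)
  have h2' : |Real.cos (θ / 2) - (1 - (θ / 2) ^ 2 / 2)| ≤ θ ^ 4 * (5 / 1536) := by
    refine h2.trans_eq ?_
    rw [Even.pow_abs (by decide)]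
    ring
  have hup := Real.one_sub_sq_div_two_le_cos (x := θ / 2)
  set y := 1 - Real.cos (θ / 2) with hy
  have hy0 : 0 ≤ y := by linarith
  have hy1 : y ≤ 1 / 8 := by linarith
  have hyθ : y ≤ θ ^ 2 / 8 := by nlinarith
  have h3 := Real.abs_log_sub_add_sum_range_le (x := y) (by rw [abs_of_nonneg hy0]; linarith) 1
  have hcy : 1 - y = Real.cos (θ / 2) := by rw [hy]; ring
  simp only [Finset.sum_range_one, hcy, abs_of_nonneg hy0] at h3
  norm_num at h3
  have h4 : y ^ 2 / Real.cos (θ / 2) ≤ θ ^ 4 / 56 := by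
    rw [div_le_iff₀ (by linarith)]
    have : y ^ 2 ≤ (θ ^ 2 / 8) ^ 2 := by gcongr
    nlinarith [sq_nonneg (θ ^ 2)]
  rw [abs_le] at h2' h3 ⊢
  have : 0 ≤ θ ^ 4 := by positivity
  constructor <;> nlinarith

/-- The third cumulant rate. -/
noncomputable def thirdCumulant : ℝ := (2 - 3 * Real.log 2) / (2 * Real.log 2) ^ 3

/-- Third order expansion of the logarithm of the closest pole. -/
lemma exists_pole_div_log_eq_exp {θ : ℝ} (hθ : |θ| ≤ 1 / 4) :
    ∃ R : ℂ, ‖R‖ ≤ 16 * θ ^ 4 ∧ Real.log 2 / pole θ =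
      Complex.exp (((1 / (2 * Real.log 2) * θ : ℝ) : ℂ) * Complex.I -
        ((1 - Real.log 2) / (2 * Real.log 2) ^ 2 * θ ^ 2 / 2 : ℝ) -
        ((thirdCumulant * θ ^ 3 / 6 : ℝ) : ℂ) * Complex.I + R) := by
  have hL9 := Real.log_two_gt_d9
  have hLne : Real.log 2 ≠ 0 := by linarith
  have hρ := abs_log_cos_half_add_le (hθ.trans (by norm_num))
  set L := Real.log 2 with hLdef
  set l := Real.log (Real.cos (θ / 2)) with hl
  have hθ0 := abs_nonneg θ
  have hsq : θ ^ 2 = |θ| ^ 2 := (sq_abs θ).symm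
  have h4 : θ ^ 4 = |θ| ^ 4 := (Even.pow_abs (by decide) θ).symm
  have hθ2 : |θ| ^ 2 ≤ 1 / 16 := by nlinarith
  set α : ℂ := -((θ / (2 * L) : ℝ) * Complex.I) with hα
  set β : ℂ := ((l / L : ℝ) : ℂ) with hβ
  set β₀ : ℂ := ((-(θ ^ 2 / 8) / L : ℝ) : ℂ) with hβ₀
  have hαn : ‖α‖ ≤ |θ| := by
    rw [hα, norm_neg, norm_mul, Complex.norm_I, mul_one, Complex.norm_real, Real.norm_eq_abs,
      abs_div, abs_of_pos (show 0 < 2 * L by linarith), div_le_iff₀ (by linarith)]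
    nlinarith
  have hln : |l| ≤ |θ| ^ 2 / 4 := by
    rw [h4, abs_le] at hρ
    rw [hsq] at hρ
    have : |θ| ^ 4 = |θ| ^ 2 * |θ| ^ 2 := by ring
    rw [abs_le]
    constructor <;> nlinarith [sq_nonneg |θ|]
  have hβn : ‖β‖ ≤ |θ| ^ 2 := by
    rw [hβ, Complex.norm_real, Real.norm_eq_abs, abs_div, abs_of_pos (show 0 < L by linarith),
      div_le_iff₀ (by linarith)]
    nlinarith [sq_nonneg |θ|]
  have hββ₀ : ‖β - β₀‖ ≤ |θ| ^ 4 := by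
    rw [hβ, hβ₀, ← Complex.ofReal_sub, Complex.norm_real, Real.norm_eq_abs, ← sub_div, abs_div,
      abs_of_pos (show 0 < L by linarith), div_le_iff₀ (by linarith), sub_neg_eq_add]
    rw [h4] at hρ
    have : 0 ≤ |θ| ^ 4 := by positivity
    nlinarith
  have hv : ‖α + β‖ ≤ 2 * |θ| := by
    refine (norm_add_le _ _).trans ?_
    nlinarith
  have hv1 : ‖α + β‖ < 1 := by linarith
  have hlog := Complex.norm_log_sub_logTaylor_le 3 hv1
  have hT : Complex.logTaylor (3 + 1) (α + β) = (α + β) - (α + β) ^ 2 / 2 + (α + β) ^ 3 / 3 := by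
    simp [Complex.logTaylor, Finset.sum_range_succ]
    ring
  rw [hT] at hlog
  have hlog' : ‖Complex.log (1 + (α + β)) -
      ((α + β) - (α + β) ^ 2 / 2 + (α + β) ^ 3 / 3)‖ ≤ 8 * |θ| ^ 4 := by
    refine hlog.trans ?_
    have h1 : (1 - ‖α + β‖)⁻¹ ≤ 2 := by
      rw [inv_le_comm₀ (by linarith) (by norm_num)]
      linarith
    calc _ ≤ (2 * |θ|) ^ (3 + 1) * 2 / ((3 : ℕ) + 1) := by gcongr
      _ = 8 * |θ| ^ 4 := by push_cast; ring
  have hpoly : ‖(β - β₀) - α * (β - β₀) - β ^ 2 / 2 + α ^ 2 * β + α * β ^ 2 + β ^ 3 / 3‖ ≤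
      8 * |θ| ^ 4 := by
    have e1 : ‖α * (β - β₀)‖ ≤ 1 * |θ| ^ 4 := by
      rw [norm_mul]; gcongr; linarith
    have e2 : ‖β ^ 2 / 2‖ ≤ |θ| ^ 4 := by
      rw [norm_div, norm_pow, Complex.norm_ofNat]
      have : ‖β‖ ^ 2 ≤ (|θ| ^ 2) ^ 2 := by gcongr
      have : 0 ≤ |θ| ^ 4 := by positivity
      nlinarith
    have e3 : ‖α ^ 2 * β‖ ≤ |θ| ^ 4 := by
      rw [norm_mul, norm_pow]
      calc _ ≤ |θ| ^ 2 * |θ| ^ 2 := by gcongr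
        _ = _ := by ring
    have e4 : ‖α * β ^ 2‖ ≤ |θ| ^ 4 := by
      rw [norm_mul, norm_pow]
      calc _ ≤ 1 * (|θ| ^ 2) ^ 2 := by gcongr; linarith
        _ = _ := by ring
    have e5 : ‖β ^ 3 / 3‖ ≤ |θ| ^ 4 := by
      rw [norm_div, norm_pow, Complex.norm_ofNat]
      calc _ ≤ (|θ| ^ 2) ^ 3 / 3 := by gcongr
        _ = |θ| ^ 4 * (|θ| ^ 2 / 3) := by ring
        _ ≤ |θ| ^ 4 * 1 := by gcongr; linarith
        _ = _ := mul_one _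
    have : 0 ≤ |θ| ^ 4 := by positivity
    calc _ ≤ ‖β - β₀‖ + ‖α * (β - β₀)‖ + ‖β ^ 2 / 2‖ + ‖α ^ 2 * β‖ + ‖α * β ^ 2‖ +
          ‖β ^ 3 / 3‖ := by
          refine (norm_add_le _ _).trans (add_le_add_left ?_ _)
          refine (norm_add_le _ _).trans (add_le_add_left ?_ _)
          refine (norm_add_le _ _).trans (add_le_add_left ?_ _)
          refine (norm_sub_le _ _).trans (add_le_add_left ?_ _)
          exact norm_sub_le _ _
      _ ≤ _ := by linarith
  have hne : 1 + (α + β) ≠ 0 := by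
    intro h
    have : ‖α + β‖ = 1 := by
      rw [← neg_eq_of_add_eq_zero_right h, norm_neg, norm_one]
    linarith
  have hLC : (L : ℂ) ≠ 0 := by exact_mod_cast hLne
  have hpole : L / pole θ = Complex.exp (-Complex.log (1 + (α + β))) := by
    have hpe : pole θ = L * (1 + (α + β)) := by
      rw [pole, hα, hβ, ← hLdef, ← hl]
      push_cast
      field_simp
      ring
    rw [Complex.exp_neg, Complex.exp_log hne, hpe]
    field_simp
  refine ⟨-(Complex.log (1 + (α + β)) - ((α + β) - (α + β) ^ 2 / 2 + (α + β) ^ 3 / 3)) -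
    ((β - β₀) - α * (β - β₀) - β ^ 2 / 2 + α ^ 2 * β + α * β ^ 2 + β ^ 3 / 3), ?_, ?_⟩
  · refine (norm_sub_le _ _).trans ?_
    rw [norm_neg, h4]
    linarith
  · rw [hpole]
    congr 1
    have e : -Complex.log (1 + (α + β)) = -(α + β₀ - α ^ 2 / 2 - α * β₀ + α ^ 3 / 3) +
      (-(Complex.log (1 + (α + β)) - ((α + β) - (α + β) ^ 2 / 2 + (α + β) ^ 3 / 3)) -
      ((β - β₀) - α * (β - β₀) - β ^ 2 / 2 + α ^ 2 * β + α * β ^ 2 + β ^ 3 / 3)) := by ring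
    rw [e]
    congr 1
    rw [hα, hβ₀, thirdCumulant, ← hLdef]
    push_cast
    have hI3 : Complex.I ^ 3 = -Complex.I := Complex.I_pow_three
    field_simp
    simp only [Complex.I_sq, hI3]
    ring

/-- Expansion of the centred main term. -/
lemma exists_mainTerm_mul_exp_eq {θ : ℝ} (hθ : |θ| ≤ 1 / 4) (n : ℕ) :
    ∃ R : ℂ, ‖R‖ ≤ 17 * ((n : ℝ) + 1) * θ ^ 4 ∧
      mainTerm n θ * Complex.exp (-((a n * θ : ℝ) * Complex.I)) =
        Complex.exp (-(b n * θ ^ 2 / 2 : ℝ) +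
          (-((((n : ℝ) + 1) * thirdCumulant * θ ^ 3 / 6 : ℝ) * Complex.I) + R)) := by
  obtain ⟨R, hR, h⟩ := exists_pole_div_log_eq_exp hθ
  have hθ1 : |θ| ≤ 1 := hθ.trans (by norm_num)
  have hcos := cos_half_ge hθ1
  have hl := abs_log_cos_half_add_le hθ1
  have hcosexp : (Real.cos (θ / 2) : ℂ) = Complex.exp (Real.log (Real.cos (θ / 2)) : ℝ) := by
    rw [← Complex.ofReal_exp, Real.exp_log (by linarith)]
  set l := Real.log (Real.cos (θ / 2))
  refine ⟨-((l + θ ^ 2 / 8 : ℝ) : ℂ) + (n + 1) * R, ?_, ?_⟩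
  · refine (norm_add_le _ _).trans ?_
    have h1 : ‖((n : ℂ) + 1)‖ = (n : ℝ) + 1 := by
      rw [← Nat.cast_succ, Complex.norm_natCast]; simp
    have h0 : 0 ≤ θ ^ 4 := by positivity
    have hn : (0 : ℝ) ≤ n := n.cast_nonneg
    rw [norm_neg, Complex.norm_real, Real.norm_eq_abs, norm_mul, h1]
    nlinarith [mul_nonneg hn h0, mul_le_mul_of_nonneg_left hR (show (0 : ℝ) ≤ n + 1 by positivity)]
  · rw [mainTerm, h, hcosexp, ← Complex.exp_nat_mul, ← Complex.exp_sub, ← Complex.exp_add,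
      ← Complex.exp_add]
    congr 1
    rw [a, b]
    push_cast
    ring

/-- The Fourier transform of the Edgeworth approximation. -/
noncomputable def edgeworth (N β k θ : ℝ) : ℂ :=
  Complex.exp (-(β * θ ^ 2 / 2 : ℝ)) * (1 - (N * k * θ ^ 3 / 6 : ℝ) * Complex.I)

lemma add_pow_le_mul_exp {Y : ℝ} (hY : 0 ≤ Y) :
    Y ^ 3 + 17 * Y ^ 2 ≤ 10 ^ 8 * Real.exp (Y / 80) ∧
      10 ^ 6 * Y + 10 ^ 3 * Y ^ 2 ≤ 10 ^ 8 * Real.exp (Y / 80) := by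
  have h0 : 0 ≤ Y / 80 := by positivity
  have h1 := Real.pow_div_factorial_le_exp _ h0 1
  have h2 := Real.pow_div_factorial_le_exp _ h0 2
  have h3 := Real.pow_div_factorial_le_exp _ h0 3
  simp only [Nat.factorial] at h1 h2 h3
  norm_num at h1 h2 h3
  constructor <;> nlinarith [Real.exp_pos (Y / 80)]

lemma norm_exp_sub_edgeworth_le {N β k θ : ℝ} {R : ℂ} (hN : 1 ≤ N) (hβ : N / 10 ≤ β)
    (hk : |k| ≤ 1) (hθ : |θ| ≤ 1 / 1000) (hR : ‖R‖ ≤ 17 * N * θ ^ 4) :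
    ‖Complex.exp (-(β * θ ^ 2 / 2 : ℝ) + (-((N * k * θ ^ 3 / 6 : ℝ) * Complex.I) + R)) -
      edgeworth N β k θ‖ ≤ 10 ^ 8 / N * Real.exp (-(N * θ ^ 2 / 80)) := by
  have hN0 : 0 < N := by linarith
  set w : ℂ := -((N * k * θ ^ 3 / 6 : ℝ) * Complex.I) + R with hw
  set Y := N * θ ^ 2 with hY
  have hY0 : 0 ≤ Y := by positivity
  have hθ0 := abs_nonneg θ
  have h4 : θ ^ 4 = |θ| ^ 3 * |θ| := by rw [← Even.pow_abs (by decide) θ]; ring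
  have h2 : θ ^ 2 = |θ| ^ 2 := (sq_abs θ).symm
  have hc : 0 ≤ N * |θ| ^ 3 := by positivity
  have hwn : ‖w‖ ≤ N * |θ| ^ 3 := by
    refine (norm_add_le _ _).trans ?_
    have e1 : ‖-(((N * k * θ ^ 3 / 6 : ℝ) : ℂ) * Complex.I)‖ ≤ N * |θ| ^ 3 / 6 := by
      rw [norm_neg, norm_mul, Complex.norm_I, mul_one, Complex.norm_real, Real.norm_eq_abs,
        abs_div, abs_mul, abs_mul, abs_pow, abs_of_pos hN0, abs_of_pos (by norm_num : (0 : ℝ) < 6)]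
      gcongr
      exact mul_le_of_le_one_right hN0.le hk
    rw [h4] at hR
    nlinarith
  have hwY : ‖w‖ ≤ Y / 1000 := by
    rw [hY, h2]
    refine hwn.trans ?_
    have : 0 ≤ N * |θ| ^ 2 := by positivity
    nlinarith
  have hw2 : ‖w‖ ^ 2 ≤ Y ^ 3 / N := by
    calc ‖w‖ ^ 2 ≤ (N * |θ| ^ 3) ^ 2 := by gcongr
      _ = Y ^ 3 / N := by rw [hY, h2]; field_simp
  have hRY : ‖R‖ ≤ 17 * Y ^ 2 / N := by
    refine hR.trans_eq ?_
    rw [hY]; field_simp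
  have hexp := Complex.norm_exp_sub_sum_le_norm_mul_exp w 2
  simp only [Finset.sum_range_succ, Finset.sum_range_zero] at hexp
  norm_num at hexp
  have hid : Complex.exp (-(β * θ ^ 2 / 2 : ℝ) + w) - edgeworth N β k θ =
      Complex.exp (-(β * θ ^ 2 / 2 : ℝ)) * ((Complex.exp w - (1 + w)) + R) := by
    rw [edgeworth, Complex.exp_add, hw]
    ring
  rw [hid, norm_mul, ← Complex.ofReal_neg, Complex.norm_exp, Complex.ofReal_re]
  have hR' : ‖R‖ ≤ 17 * Y ^ 2 / N * Real.exp (Y / 1000) :=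
    hRY.trans (le_mul_of_one_le_right (by positivity) (Real.one_le_exp (by positivity)))
  calc _ ≤ Real.exp (-(Y / 20)) * (Y ^ 3 / N * Real.exp (Y / 1000) +
        17 * Y ^ 2 / N * Real.exp (Y / 1000)) := by
        refine mul_le_mul (Real.exp_le_exp.2 ?_)
          ((norm_add_le _ _).trans (add_le_add (hexp.trans ?_) hR')) (norm_nonneg _)
          (Real.exp_pos _).le
        · rw [hY]; nlinarith [sq_nonneg θ]
        · gcongr
    _ = (Y ^ 3 + 17 * Y ^ 2) / N * Real.exp (-(Y / 20) + Y / 1000) := by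
        rw [Real.exp_add]; ring
    _ ≤ 10 ^ 8 * Real.exp (Y / 80) / N * Real.exp (-(Y / 80) + -(Y / 80)) := by
        refine mul_le_mul (div_le_div_of_nonneg_right (add_pow_le_mul_exp hY0).1 hN0.le)
          (Real.exp_le_exp.2 ?_) (Real.exp_pos _).le (by positivity)
        linarith
    _ = 10 ^ 8 / N * Real.exp (-(Y / 80)) := by
        rw [Real.exp_add, Real.exp_neg]
        have := (Real.exp_pos (Y / 80)).ne'
        field_simp

lemma norm_edgeworth_le {N β k θ : ℝ} (hN : 1 ≤ N) (hβ : N / 10 ≤ β)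
    (hk : |k| ≤ 1) (hθ : 1 / 1000 ≤ |θ|) :
    ‖edgeworth N β k θ‖ ≤ 10 ^ 8 / N * Real.exp (-(N * θ ^ 2 / 80)) := by
  have hN0 : 0 < N := by linarith
  have h2 : θ ^ 2 = |θ| ^ 2 := (sq_abs θ).symm
  set Y := N * θ ^ 2 with hY
  have hY0 : 0 ≤ Y := by positivity
  have h1 : ‖1 - ((N * k * θ ^ 3 / 6 : ℝ) : ℂ) * Complex.I‖ ≤ 1 + N * |θ| ^ 3 := by
    refine (norm_sub_le _ _).trans ?_
    rw [norm_one, norm_mul, Complex.norm_I, mul_one, Complex.norm_real, Real.norm_eq_abs,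
      abs_div, abs_mul, abs_mul, abs_pow, abs_of_pos hN0, abs_of_pos (by norm_num : (0 : ℝ) < 6)]
    have e1 : N * |k| * |θ| ^ 3 ≤ N * 1 * |θ| ^ 3 := by gcongr
    have e2 : 0 ≤ N * |θ| ^ 3 := by positivity
    linarith
  have h3 : 1 + N * |θ| ^ 3 ≤ (10 ^ 6 * Y + 10 ^ 3 * Y ^ 2) / N := by
    rw [le_div_iff₀ hN0, hY, h2]
    have e1 : 1 ≤ 10 ^ 6 * |θ| ^ 2 := by nlinarith
    have e2 : |θ| ^ 3 * 1 ≤ |θ| ^ 3 * (10 ^ 3 * |θ|) := by gcongr; linarith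
    have e3 := mul_le_mul_of_nonneg_left e2 (sq_nonneg N)
    nlinarith
  rw [edgeworth, norm_mul, ← Complex.ofReal_neg, Complex.norm_exp, Complex.ofReal_re]
  calc _ ≤ Real.exp (-(Y / 80) + -(Y / 80)) * (10 ^ 8 * Real.exp (Y / 80) / N) := by
        refine mul_le_mul (Real.exp_le_exp.2 ?_) (h1.trans (h3.trans
          (div_le_div_of_nonneg_right (add_pow_le_mul_exp hY0).2 hN0.le))) (norm_nonneg _)
          (Real.exp_pos _).le
        rw [hY]; nlinarith [sq_nonneg θ]
    _ = 10 ^ 8 / N * Real.exp (-(Y / 80)) := by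
        rw [Real.exp_add, Real.exp_neg]
        have := (Real.exp_pos (Y / 80)).ne'
        field_simp

/-- The integrand of the Fourier inversion formula for the normal distribution. -/
noncomputable def gaussKernel (β y θ : ℝ) : ℂ :=
  Complex.exp (-(β * θ ^ 2 / 2 : ℝ)) * Complex.exp (-((y * θ : ℝ) * Complex.I))

lemma norm_gaussKernel (β y θ : ℝ) : ‖gaussKernel β y θ‖ = Real.exp (-(β / 2) * θ ^ 2) := by
  rw [gaussKernel, norm_mul, ← Complex.ofReal_neg, Complex.norm_exp, Complex.ofReal_re, ← neg_mul,
    ← Complex.ofReal_neg, Complex.norm_exp_ofReal_mul_I, mul_one]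
  congr 1
  ring

lemma integrable_pow_mul_gaussKernel {β : ℝ} (hβ : 0 < β) (y : ℝ) (m : ℕ) :
    MeasureTheory.Integrable fun θ : ℝ => (θ : ℂ) ^ m * gaussKernel β y θ := by
  have h := integrable_rpow_mul_exp_neg_mul_sq (half_pos hβ) (s := m)
    (by linarith [(Nat.cast_nonneg m : (0 : ℝ) ≤ m)])
  simp only [Real.rpow_natCast] at h
  refine h.mono ?_ (Filter.Eventually.of_forall fun θ => ?_)
  · unfold gaussKernel
    exact Continuous.aestronglyMeasurable (by fun_prop)
  · rw [norm_mul, norm_mul, norm_gaussKernel, norm_pow, norm_pow, Complex.norm_real,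
      Real.norm_of_nonneg (Real.exp_pos _).le]

lemma hasDerivAt_gaussKernel (β y θ : ℝ) :
    HasDerivAt (gaussKernel β y) (-(β * θ + y * Complex.I) * gaussKernel β y θ) θ := by
  have h1 : HasDerivAt (fun θ : ℝ => (θ : ℂ)) 1 θ := Complex.ofRealCLM.hasDerivAt
  have h2 : HasDerivAt (fun θ : ℝ => -(β * (θ : ℂ) ^ 2 / 2) + -(y * (θ : ℂ) * Complex.I))
      (-(β * θ + y * Complex.I)) θ := by
    have := (((h1.pow 2).const_mul (β : ℂ)).div_const 2).neg.add
      (((h1.const_mul (y : ℂ)).mul_const Complex.I).neg)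
    refine this.congr_deriv ?_
    push_cast
    ring
  have h3 := h2.cexp
  have h4 : gaussKernel β y = fun θ : ℝ =>
      Complex.exp (-(β * (θ : ℂ) ^ 2 / 2) + -(y * (θ : ℂ) * Complex.I)) := by
    funext θ
    rw [gaussKernel, ← Complex.exp_add]
    push_cast
    rfl
  rw [h4]
  convert h3 using 1
  ring

lemma integral_gaussKernel {β : ℝ} (hβ : 0 < β) (y : ℝ) :
    ∫ θ, gaussKernel β y θ = (Real.sqrt (2 * Real.pi / β) * Real.exp (-y ^ 2 / (2 * β)) : ℝ) := by
  have hb : 0 < ((β / 2 : ℝ) : ℂ).re := by simpa using hβ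
  have h := fourierIntegral_gaussian hb (-y : ℝ)
  have h1 : ∀ θ : ℝ, gaussKernel β y θ = Complex.exp (Complex.I * (-y : ℝ) * θ) *
      Complex.exp (-(β / 2 : ℝ) * (θ : ℂ) ^ 2) := fun θ => by
    rw [gaussKernel, mul_comm]
    congr 2 <;> push_cast <;> ring
  simp only [h1]
  rw [h, Real.sqrt_eq_rpow, Complex.ofReal_mul, Complex.ofReal_cpow (by positivity),
    Complex.ofReal_exp]
  congr 2
  · push_cast
    field_simp
  · norm_num
  · push_cast
    have : (β : ℂ) ≠ 0 := by exact_mod_cast hβ.ne'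
    field_simp
    norm_num

/-- Integration by parts for the moments of the Gaussian kernel. -/
lemma integral_pow_mul_gaussKernel_rec {β : ℝ} (hβ : 0 < β) (y : ℝ) (m : ℕ) :
    β * ∫ θ : ℝ, (θ : ℂ) ^ (m + 1) * gaussKernel β y θ =
      m * (∫ θ : ℝ, (θ : ℂ) ^ (m - 1) * gaussKernel β y θ) -
        y * Complex.I * ∫ θ : ℝ, (θ : ℂ) ^ m * gaussKernel β y θ := by
  have hi := integrable_pow_mul_gaussKernel hβ y
  have hd : ∀ θ : ℝ, HasDerivAt (fun θ : ℝ => (θ : ℂ) ^ m * gaussKernel β y θ)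
      (m * ((θ : ℂ) ^ (m - 1) * gaussKernel β y θ) -
        y * Complex.I * ((θ : ℂ) ^ m * gaussKernel β y θ) -
        β * ((θ : ℂ) ^ (m + 1) * gaussKernel β y θ)) θ := fun θ => by
    have h1 : HasDerivAt (fun θ : ℝ => (θ : ℂ)) 1 θ := Complex.ofRealCLM.hasDerivAt
    refine ((h1.pow m).mul (hasDerivAt_gaussKernel β y θ)).congr_deriv ?_
    simp only [Pi.pow_apply]
    ring
  have h := MeasureTheory.integral_eq_zero_of_hasDerivAt_of_integrable hd
    ((((hi (m - 1)).const_mul _).sub ((hi m).const_mul _)).sub ((hi (m + 1)).const_mul _)) (hi m)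
  have hs := ((hi (m - 1)).const_mul (m : ℂ)).sub ((hi m).const_mul (y * Complex.I))
  simp only [Pi.sub_def] at hs
  rw [MeasureTheory.integral_sub hs ((hi (m + 1)).const_mul _), MeasureTheory.integral_sub ((hi (m - 1)).const_mul _)
    ((hi m).const_mul _), MeasureTheory.integral_const_mul, MeasureTheory.integral_const_mul,
    MeasureTheory.integral_const_mul] at h
  linear_combination -h

lemma edgeworth_mul_exp (N β k y θ : ℝ) :
    edgeworth N β k θ * Complex.exp (-((y * θ : ℝ) * Complex.I)) =
      gaussKernel β y θ - (N * k / 6 : ℝ) * Complex.I * ((θ : ℂ) ^ 3 * gaussKernel β y θ) := by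
  rw [edgeworth, gaussKernel]
  push_cast
  ring

lemma integrable_edgeworth_mul_exp {β : ℝ} (hβ : 0 < β) (N k y : ℝ) :
    MeasureTheory.Integrable fun θ : ℝ =>
      edgeworth N β k θ * Complex.exp (-((y * θ : ℝ) * Complex.I)) := by
  simp only [edgeworth_mul_exp]
  have h0 := integrable_pow_mul_gaussKernel hβ y 0
  simp only [pow_zero, one_mul] at h0
  exact h0.sub ((integrable_pow_mul_gaussKernel hβ y 3).const_mul _)

lemma integral_edgeworth_mul_exp {β : ℝ} (hβ : 0 < β) (N k y : ℝ) :
    ∫ θ : ℝ, edgeworth N β k θ * Complex.exp (-((y * θ : ℝ) * Complex.I)) =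
      (Real.sqrt (2 * Real.pi / β) * Real.exp (-y ^ 2 / (2 * β)) *
        (1 + N * k / 6 * (y ^ 3 / β ^ 3 - 3 * y / β ^ 2)) : ℝ) := by
  have hi := integrable_pow_mul_gaussKernel hβ y
  have hi0 := hi 0
  simp only [pow_zero, one_mul] at hi0
  have h0 := integral_gaussKernel hβ y
  have h1 := integral_pow_mul_gaussKernel_rec hβ y 0
  have h2 := integral_pow_mul_gaussKernel_rec hβ y 1
  have h3 := integral_pow_mul_gaussKernel_rec hβ y 2
  simp only [edgeworth_mul_exp]
  rw [MeasureTheory.integral_sub hi0 ((hi 3).const_mul _), MeasureTheory.integral_const_mul]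
  norm_num at h1 h2 h3
  have hβ0 : (β : ℂ) ≠ 0 := by exact_mod_cast hβ.ne'
  rw [Complex.ofReal_mul, ← h0]
  set J := ∫ θ, gaussKernel β y θ
  set J1 := ∫ θ : ℝ, (θ : ℂ) * gaussKernel β y θ
  set J2 := ∫ θ : ℝ, (θ : ℂ) ^ 2 * gaussKernel β y θ
  set J3 := ∫ θ : ℝ, (θ : ℂ) ^ 3 * gaussKernel β y θ
  have e : (β : ℂ) ^ 3 * J3 = Complex.I * (y ^ 3 - 3 * y * β) * J := by
    linear_combination (β : ℂ) ^ 2 * h3 - y * Complex.I * β * h2 +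
      (2 * β - y ^ 2 + (1 + Complex.I ^ 2) * y ^ 2) * h1 -
      y ^ 3 * Complex.I * Complex.I_sq * J
  have e' : J3 = Complex.I * (y ^ 3 - 3 * y * β) * J / (β : ℂ) ^ 3 := by
    rw [eq_div_iff (pow_ne_zero 3 hβ0), ← e, mul_comm]
  rw [e']
  push_cast
  field_simp
  linear_combination (-(J * N * k * (y ^ 3 - 3 * y * β))) * Complex.I_sq

lemma integral_exp_int_mul_I (m : ℤ) :
    ∫ θ in (-Real.pi)..Real.pi, Complex.exp ((m * θ : ℝ) * Complex.I) =
      if m = 0 then 2 * (Real.pi : ℂ) else 0 := by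
  by_cases hm : m = 0
  · simp [hm]
    ring
  · have hc : (m : ℂ) * Complex.I ≠ 0 := mul_ne_zero (by exact_mod_cast hm) Complex.I_ne_zero
    have h1 : ∀ θ : ℝ, Complex.exp ((m * θ : ℝ) * Complex.I) =
        Complex.exp (m * Complex.I * θ) := fun θ => by
      congr 1
      push_cast
      ring
    simp only [h1, hm, if_false]
    rw [integral_exp_mul_complex hc]
    have h2 : Complex.exp (m * Complex.I * Real.pi) =
        Complex.exp (m * Complex.I * (-Real.pi : ℝ)) := by
      rw [Complex.exp_eq_exp_iff_exists_int]
      exact ⟨m, by push_cast; ring⟩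
    rw [h2, sub_self, zero_div]

/-- Fourier inversion for the coefficients of the Fubini polynomials. -/
lemma integral_fubini_mul_exp (n : ℕ) (j : ℤ) :
    ∫ θ in (-Real.pi)..Real.pi,
      fubini n (Complex.exp (θ * Complex.I)) * Complex.exp (-((j * θ : ℝ) * Complex.I)) =
      2 * Real.pi * (if 0 ≤ j then (surj n j.toNat : ℂ) else 0) := by
  have h1 : ∀ θ : ℝ, fubini n (Complex.exp (θ * Complex.I)) *
      Complex.exp (-((j * θ : ℝ) * Complex.I)) = ∑ i ∈ Finset.range (n + 1),
        (surj n i : ℂ) * Complex.exp ((((i : ℤ) - j : ℤ) * θ : ℝ) * Complex.I) := fun θ => by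
    rw [fubini, Finset.sum_mul]
    refine Finset.sum_congr rfl fun i _ => ?_
    rw [mul_assoc, ← Complex.exp_nat_mul, ← Complex.exp_add]
    congr 2
    push_cast
    ring
  simp only [h1]
  rw [intervalIntegral.integral_finsetSum fun i _ =>
    Continuous.intervalIntegrable (by fun_prop) _ _]
  simp only [intervalIntegral.integral_const_mul, integral_exp_int_mul_I, sub_eq_zero]
  split_ifs with hj
  · obtain ⟨m, rfl⟩ := Int.eq_ofNat_of_zero_le hj
    simp only [Nat.cast_inj, mul_ite, mul_zero, Int.toNat_natCast]
    rw [Finset.sum_ite_eq']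
    split_ifs with hm
    · ring
    · rw [surj_eq_zero_of_lt (by simpa using hm)]
      simp
  · rw [mul_zero]
    refine Finset.sum_eq_zero fun i _ => ?_
    rw [if_neg (by omega), mul_zero]

lemma normalizedStirling_eq (n : ℕ) (j : ℤ) :
    (normalizedStirling n j : ℂ) = (Real.sqrt (b n) / (2 * Real.pi) : ℝ) *
      ∫ θ in (-Real.pi)..Real.pi, 2 * Real.log 2 * renewal n (Complex.exp (θ * Complex.I)) *
        Complex.exp (-((j * θ : ℝ) * Complex.I)) := by
  have h1 : ∀ θ : ℝ, 2 * Real.log 2 * renewal n (Complex.exp (θ * Complex.I)) *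
      Complex.exp (-((j * θ : ℝ) * Complex.I)) =
      (2 * Real.log 2 * (Real.log 2 ^ n / (n.factorial : ℝ)) : ℝ) *
        (fubini n (Complex.exp (θ * Complex.I)) * Complex.exp (-((j * θ : ℝ) * Complex.I))) :=
    fun θ => by
      rw [renewal]
      push_cast
      ring
  simp only [h1]
  rw [intervalIntegral.integral_const_mul, integral_fubini_mul_exp, normalizedStirling]
  have hpi : (Real.pi : ℂ) ≠ 0 := by exact_mod_cast Real.pi_ne_zero
  split_ifs
  · rw [surj]
    push_cast
    field_simp
    ring
  · simp

lemma le_b {n : ℕ} (hn : 10 ≤ n) : ((n : ℝ) + 1) / 10 ≤ b n := by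
  have h1 := Real.log_two_gt_d9
  have h2 := Real.log_two_lt_d9
  have hn' : (10 : ℝ) ≤ n := by exact_mod_cast hn
  have h3 : 3 / 20 ≤ (1 - Real.log 2) / (2 * Real.log 2) ^ 2 := by
    rw [le_div_iff₀ (by positivity)]
    nlinarith
  rw [b]
  nlinarith

lemma b_le (n : ℕ) : b n ≤ (n : ℝ) + 1 := by
  have h1 := Real.log_two_gt_d9
  have hn' : (0 : ℝ) ≤ n := n.cast_nonneg
  have h3 : (1 - Real.log 2) / (2 * Real.log 2) ^ 2 ≤ 1 := by
    rw [div_le_one (by positivity)]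
    nlinarith
  rw [b]
  nlinarith

lemma abs_thirdCumulant_le : |thirdCumulant| ≤ 1 := by
  have h1 := Real.log_two_gt_d9
  have h2 := Real.log_two_lt_d9
  have h3 : 1 ≤ (2 * Real.log 2) ^ 3 := one_le_pow₀ (by linarith)
  rw [thirdCumulant, abs_div, abs_of_pos (show 0 < (2 * Real.log 2) ^ 3 by positivity),
    div_le_one (by positivity), abs_le]
  constructor <;> linarith

lemma norm_exp_neg_ofReal_mul_I (y : ℝ) : ‖Complex.exp (-(y * Complex.I))‖ = 1 := by
  rw [← neg_mul, ← Complex.ofReal_neg, Complex.norm_exp_ofReal_mul_I]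

/-- The centred characteristic function is uniformly close to its Edgeworth approximation. -/
lemma exists_norm_renewal_sub_edgeworth_le :
    ∃ C > (0 : ℝ), ∃ r > (1 : ℝ), ∀ (n : ℕ) (θ : ℝ), 10 ≤ n → |θ| ≤ Real.pi →
      ‖2 * Real.log 2 * renewal n (Complex.exp (θ * Complex.I)) *
          Complex.exp (-((a n * θ : ℝ) * Complex.I)) -
        edgeworth ((n : ℝ) + 1) (b n) thirdCumulant θ‖ ≤
      10 ^ 8 / ((n : ℝ) + 1) * Real.exp (-(((n : ℝ) + 1) * θ ^ 2 / 80)) + C / r ^ n := by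
  obtain ⟨r, hr, C, hC, hfar⟩ := exists_norm_renewal_le (δ := 1 / 1000) (by norm_num)
    (by linarith [Real.pi_gt_three])
  obtain ⟨C', hC', hnear⟩ := exists_norm_renewal_sub_mainTerm_le
  have hL : 0 < Real.log 2 := Real.log_pos one_lt_two
  have hL1 : Real.log 2 ≤ 1 := by linarith [Real.log_two_lt_d9]
  have hs : 1 < min r 5 := lt_min hr (by norm_num)
  refine ⟨2 * C + C', by positivity, min r 5, hs, fun n θ hn hθ => ?_⟩
  have hN : (1 : ℝ) ≤ (n : ℝ) + 1 := by linarith [(Nat.cast_nonneg n : (0 : ℝ) ≤ n)]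
  have hp : 0 < min r 5 ^ n := by positivity
  rcases le_total |θ| (1 / 1000) with h | h
  · obtain ⟨R, hR, hm⟩ := exists_mainTerm_mul_exp_eq (h.trans (by norm_num)) n
    have h1 := hnear n θ (by omega) (h.trans (by norm_num))
    have h2 := norm_exp_sub_edgeworth_le hN (le_b hn) abs_thirdCumulant_le h hR
    rw [← hm] at h2
    set φ := 2 * Real.log 2 * renewal n (Complex.exp (θ * Complex.I))
    set e := Complex.exp (-((a n * θ : ℝ) * Complex.I)) with he
    have he1 : ‖e‖ = 1 := norm_exp_neg_ofReal_mul_I _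
    have hsplit : φ * e - edgeworth ((n : ℝ) + 1) (b n) thirdCumulant θ =
        (mainTerm n θ * e - edgeworth ((n : ℝ) + 1) (b n) thirdCumulant θ) +
          (φ - mainTerm n θ) * e := by ring
    rw [hsplit]
    refine (norm_add_le _ _).trans (add_le_add h2 ?_)
    rw [norm_mul, he1, mul_one, le_div_iff₀ hp]
    calc _ ≤ ‖φ - mainTerm n θ‖ * 5 ^ n := by
          gcongr
          exact min_le_right _ _
      _ ≤ _ := by linarith
  · have h1 := hfar n θ h hθ
    have h2 := norm_edgeworth_le hN (le_b hn) abs_thirdCumulant_le h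
    refine (norm_sub_le _ _).trans ?_
    rw [add_comm]
    refine add_le_add h2 ?_
    rw [norm_mul, norm_exp_neg_ofReal_mul_I, mul_one, norm_mul, norm_mul, Complex.norm_ofNat,
      Complex.norm_real, Real.norm_of_nonneg hL.le, le_div_iff₀ hp]
    calc _ ≤ 2 * 1 * ‖renewal n (Complex.exp (θ * Complex.I))‖ * r ^ n := by
          gcongr
          exact min_le_left _ _
      _ ≤ _ := by linarith

/-- Fourier inversion of the Edgeworth approximation. -/
lemma edgeworth_inversion {n : ℕ} (hn : 10 ≤ n) (j : ℤ) :
    ((1 / Real.sqrt (2 * Real.pi) * Real.exp (-(x n j) ^ 2 / 2) *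
        (1 + c n * ((x n j) ^ 3 - 3 * x n j) / (6 * Real.sqrt n)) : ℝ) : ℂ) =
      (Real.sqrt (b n) / (2 * Real.pi) : ℝ) *
        ∫ θ : ℝ, edgeworth ((n : ℝ) + 1) (b n) thirdCumulant θ *
          Complex.exp (-((((j : ℝ) - a n) * θ : ℝ) * Complex.I)) := by
  have hn0 : (10 : ℝ) ≤ n := by exact_mod_cast hn
  have hb : 0 < b n := lt_of_lt_of_le (by positivity) (le_b hn)
  have hL : 0 < Real.log 2 := Real.log_pos one_lt_two
  rw [integral_edgeworth_mul_exp hb, ← Complex.ofReal_mul]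
  congr 1
  set y := (j : ℝ) - a n with hy
  obtain ⟨s, hs, hbs⟩ : ∃ s > 0, b n = s ^ 2 :=
    ⟨Real.sqrt (b n), Real.sqrt_pos.2 hb, (Real.sq_sqrt hb.le).symm⟩
  have hn1 : Real.sqrt n ≠ 0 := (Real.sqrt_pos.2 (by linarith)).ne'
  have h2pi := Real.sqrt_pos.2 Real.two_pi_pos
  have h2pi' := Real.sq_sqrt Real.two_pi_pos.le
  rw [x, c, ← hy, thirdCumulant, hbs, Real.sqrt_sq hs.le, Real.sqrt_div Real.two_pi_pos.le,
    Real.sqrt_sq hs.le]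
  have he : -(y / s) ^ 2 / 2 = -y ^ 2 / (2 * s ^ 2) := by field_simp
  rw [he]
  have h1 : 1 / Real.sqrt (2 * Real.pi) = s / (2 * Real.pi) * (Real.sqrt (2 * Real.pi) / s) := by
    nth_rw 2 [← h2pi']
    field_simp
  have h2 : Real.sqrt n * (2 - 3 * Real.log 2) * ((n : ℝ) + 1) / (2 * s * Real.log 2) ^ 3 *
      ((y / s) ^ 3 - 3 * (y / s)) / (6 * Real.sqrt n) =
      ((n : ℝ) + 1) * ((2 - 3 * Real.log 2) / (2 * Real.log 2) ^ 3) / 6 *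
        (y ^ 3 / (s ^ 2) ^ 3 - 3 * y / (s ^ 2) ^ 2) := by
    field_simp
  rw [h1, h2]
  ring

lemma continuous_renewal (n : ℕ) : Continuous (renewal n) := by
  unfold renewal fubini
  fun_prop

lemma exists_abs_normalizedStirling_sub_le :
    ∃ C > (0 : ℝ), ∃ r > (1 : ℝ), ∀ (n : ℕ) (j : ℤ), 10 ≤ n →
      |normalizedStirling n j -
          1 / Real.sqrt (2 * Real.pi) * Real.exp (-(x n j) ^ 2 / 2) *
            (1 + c n * ((x n j) ^ 3 - 3 * x n j) / (6 * Real.sqrt n))| ≤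
      Real.sqrt (b n) / (2 * Real.pi) *
        (10 ^ 8 / ((n : ℝ) + 1) * Real.sqrt (80 * Real.pi / ((n : ℝ) + 1)) +
          2 * Real.pi * (C / r ^ n)) := by
  obtain ⟨C, hC, r, hr, h⟩ := exists_norm_renewal_sub_edgeworth_le
  refine ⟨C, hC, r, hr, fun n j hn => ?_⟩
  have hb : 0 < b n := lt_of_lt_of_le (by positivity) (le_b hn)
  have hpi := Real.pi_pos
  have hr0 : 0 < r := by linarith
  set y := (j : ℝ) - a n with hy
  set S := Set.Ioc (-Real.pi) Real.pi
  set E : ℝ → ℂ := fun θ => edgeworth ((n : ℝ) + 1) (b n) thirdCumulant θ *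
    Complex.exp (-((y * θ : ℝ) * Complex.I)) with hE
  set F : ℝ → ℂ := fun θ => 2 * Real.log 2 * renewal n (Complex.exp (θ * Complex.I)) *
    Complex.exp (-((j * θ : ℝ) * Complex.I)) with hF
  have hEi : MeasureTheory.Integrable E := integrable_edgeworth_mul_exp hb _ _ _
  have hFc : Continuous F := by
    have := continuous_renewal n
    fun_prop
  have hFi : MeasureTheory.Integrable (S.indicator F) :=
    (MeasureTheory.integrable_indicator_iff measurableSet_Ioc).2
      ((hFc.integrableOn_Icc (a := -Real.pi) (b := Real.pi)).mono_set Set.Ioc_subset_Icc_self)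
  set g : ℝ → ℝ := fun θ =>
    10 ^ 8 / ((n : ℝ) + 1) * Real.exp (-(((n : ℝ) + 1) / 80) * θ ^ 2) +
      S.indicator (fun _ => C / r ^ n) θ with hg
  have hN : 0 < ((n : ℝ) + 1) / 80 := by positivity
  have hg1 : MeasureTheory.Integrable fun θ : ℝ =>
      10 ^ 8 / ((n : ℝ) + 1) * Real.exp (-(((n : ℝ) + 1) / 80) * θ ^ 2) :=
    (integrable_exp_neg_mul_sq hN).const_mul _
  have hg2 : MeasureTheory.Integrable (S.indicator fun _ : ℝ => C / r ^ n) :=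
    (MeasureTheory.integrable_indicator_iff measurableSet_Ioc).2
      (MeasureTheory.integrableOn_const (by simp))
  have hgint : ∫ θ, g θ = 10 ^ 8 / ((n : ℝ) + 1) * Real.sqrt (80 * Real.pi / ((n : ℝ) + 1)) +
      2 * Real.pi * (C / r ^ n) := by
    rw [hg, MeasureTheory.integral_add hg1 hg2, MeasureTheory.integral_const_mul,
      integral_gaussian, MeasureTheory.integral_indicator measurableSet_Ioc,
      MeasureTheory.setIntegral_const, MeasureTheory.measureReal_def, Real.volume_Ioc,
      ENNReal.toReal_ofReal (by linarith), smul_eq_mul]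
    congr 3
    · field_simp
    · ring
  have hbound : ∀ θ, ‖S.indicator F θ - E θ‖ ≤ g θ := fun θ => by
    have hexp : ∀ w : ℂ, ‖w * Complex.exp (-((y * θ : ℝ) * Complex.I))‖ = ‖w‖ := fun w => by
      rw [norm_mul, norm_exp_neg_ofReal_mul_I, mul_one]
    have he : -(((n : ℝ) + 1) / 80) * θ ^ 2 = -(((n : ℝ) + 1) * θ ^ 2 / 80) := by ring
    simp only [hg, he]
    by_cases hθ : θ ∈ S
    · rw [Set.indicator_of_mem hθ, Set.indicator_of_mem hθ]
      have hFE : F θ - E θ = (2 * Real.log 2 * renewal n (Complex.exp (θ * Complex.I)) *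
          Complex.exp (-((a n * θ : ℝ) * Complex.I)) -
          edgeworth ((n : ℝ) + 1) (b n) thirdCumulant θ) *
            Complex.exp (-((y * θ : ℝ) * Complex.I)) := by
        have : Complex.exp (-((j * θ : ℝ) * Complex.I)) =
            Complex.exp (-((a n * θ : ℝ) * Complex.I)) *
              Complex.exp (-((y * θ : ℝ) * Complex.I)) := by
          rw [← Complex.exp_add, hy]
          congr 1
          push_cast
          ring
        simp only [hF, hE, this]
        ring
      rw [hFE, hexp]
      exact h n θ hn (abs_le.2 ⟨hθ.1.le, hθ.2⟩)
    · rw [Set.indicator_of_notMem hθ, Set.indicator_of_notMem hθ, zero_sub, norm_neg, add_zero]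
      simp only [hE]
      rw [hexp]
      refine norm_edgeworth_le (by linarith [(Nat.cast_nonneg n : (0 : ℝ) ≤ n)]) (le_b hn)
        abs_thirdCumulant_le ?_
      by_contra! hlt
      rw [abs_lt] at hlt
      exact hθ ⟨by linarith [Real.pi_gt_three], by linarith [Real.pi_gt_three]⟩
  have key := MeasureTheory.norm_integral_le_of_norm_le (hg1.add hg2)
    (Filter.Eventually.of_forall hbound)
  change _ ≤ ∫ θ, g θ at key
  rw [hgint, MeasureTheory.integral_sub hFi hEi,
    MeasureTheory.integral_indicator measurableSet_Ioc] at key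
  rw [← Real.norm_eq_abs, ← Complex.norm_real, Complex.ofReal_sub, normalizedStirling_eq,
    edgeworth_inversion hn, intervalIntegral.integral_of_le (by linarith), ← mul_sub, norm_mul,
    Complex.norm_real, Real.norm_of_nonneg (by positivity)]
  gcongr

/-- Local central limit theorem for the Stirling numbers of the second kind:
uniformly in `j ∈ ℤ`, with `x = (j - a_n)/√(b_n)`,
`2 √(b_n) j! (log 2)^{n+1} {n j} / n!
  = (1/√(2π)) e^{-x²/2} (1 + c_n (x³ - 3x)/(6√n)) + o(1/√n)` as `n → ∞`. -/
theorem stirling_local_clt :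
    ∀ ε > (0 : ℝ), ∃ N : ℕ, ∀ n : ℕ, N ≤ n → ∀ j : ℤ,
      Real.sqrt n *
        |normalizedStirling n j -
          1 / Real.sqrt (2 * Real.pi) * Real.exp (-(x n j) ^ 2 / 2) *
            (1 + c n * ((x n j) ^ 3 - 3 * x n j) / (6 * Real.sqrt n))| < ε := by
  intro ε hε
  obtain ⟨C, hC, r, hr, h⟩ := exists_abs_normalizedStirling_sub_le
  have hr0 : 0 < r := by linarith
  set K : ℝ := 10 ^ 8 * Real.sqrt (80 * Real.pi)
  have hlim : Filter.Tendsto (fun n : ℕ => K * (1 / Real.sqrt n) + 2 * C * ((n : ℝ) ^ 1 / r ^ n))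
      Filter.atTop (nhds 0) := by
    have h1 : Filter.Tendsto (fun n : ℕ => 1 / Real.sqrt n) Filter.atTop (nhds 0) :=
      tendsto_const_nhds.div_atTop (Real.tendsto_sqrt_atTop.comp tendsto_natCast_atTop_atTop)
    have h2 := tendsto_pow_const_div_const_pow_of_one_lt 1 hr
    simpa using (h1.const_mul K).add (h2.const_mul (2 * C))
  obtain ⟨N, hN⟩ := Filter.eventually_atTop.1 (hlim.eventually_lt_const hε)
  refine ⟨max N 10, fun n hn j => ?_⟩
  have hn10 : 10 ≤ n := (le_max_right _ _).trans hn
  refine lt_of_le_of_lt ?_ (hN n ((le_max_left _ _).trans hn))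
  refine (mul_le_mul_of_nonneg_left (h n j hn10) (Real.sqrt_nonneg _)).trans ?_
  have hn0 : (10 : ℝ) ≤ n := by exact_mod_cast hn10
  have hM : (0 : ℝ) < (n : ℝ) + 1 := by linarith
  have hsq : Real.sqrt n * Real.sqrt (b n) ≤ (n : ℝ) + 1 := by
    calc _ ≤ Real.sqrt ((n : ℝ) + 1) * Real.sqrt ((n : ℝ) + 1) :=
          mul_le_mul (Real.sqrt_le_sqrt (by linarith)) (Real.sqrt_le_sqrt (b_le n))
            (Real.sqrt_nonneg _) (Real.sqrt_nonneg _)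
      _ = _ := Real.mul_self_sqrt hM.le
  have hpi := Real.pi_pos
  have hdiv : Real.sqrt (80 * Real.pi / ((n : ℝ) + 1)) ≤
      Real.sqrt (80 * Real.pi) * (1 / Real.sqrt n) := by
    rw [mul_one_div, ← Real.sqrt_div (by positivity)]
    exact Real.sqrt_le_sqrt (div_le_div_of_nonneg_left (by positivity) (by linarith) (by linarith))
  have hB : 0 ≤ 10 ^ 8 / ((n : ℝ) + 1) * Real.sqrt (80 * Real.pi / ((n : ℝ) + 1)) := by positivity
  have hB' : 0 ≤ 2 * Real.pi * (C / r ^ n) := by positivity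
  calc _ = Real.sqrt n * Real.sqrt (b n) / (2 * Real.pi) *
        (10 ^ 8 / ((n : ℝ) + 1) * Real.sqrt (80 * Real.pi / ((n : ℝ) + 1)) +
          2 * Real.pi * (C / r ^ n)) := by ring
    _ ≤ ((n : ℝ) + 1) / (2 * Real.pi) *
        (10 ^ 8 / ((n : ℝ) + 1) * Real.sqrt (80 * Real.pi / ((n : ℝ) + 1)) +
          2 * Real.pi * (C / r ^ n)) := by gcongr
    _ = 10 ^ 8 * Real.sqrt (80 * Real.pi / ((n : ℝ) + 1)) / (2 * Real.pi) +
        ((n : ℝ) + 1) * (C / r ^ n) := by field_simp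
    _ ≤ 10 ^ 8 * (Real.sqrt (80 * Real.pi) * (1 / Real.sqrt n)) / 1 +
        (2 * n) * (C / r ^ n) := by
        gcongr
        · linarith [Real.pi_gt_three]
        · linarith
    _ = _ := by ring
end
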